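/- Let f : X → Y be a perfect surjection of countable functional weight between paracompact Hausdorff spaces such that dim f ≤ n (every fiber f⁻¹(y) has covering dimension at most n) and dim Y ≤ m. Then the set H of all maps g ∈ C(X, I^{2n+1+m}) such that the diagonal product f × g : X → Y × I^{2n+1+m} is an embedding is dense and G_δ in C(X, I^{2n+1+m}) equipped with the source limitation topology. -/

import Mathlib

open Set Topology

noncomputable section

/-- The `k`-dimensional cube `I^k`, viewed inside Euclidean space with the Euclidean metric. -/
def cube (k : ℕ) : Set (EuclideanSpace ℝ (Fin k)) := {x | ∀ i, x i ∈ Set.Icc (0:ℝ) 1}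

/-- The Hilbert cube `I^∞`, embedded in `ℓ²` as a closed convex subset; its metric `d_∞` is the
one induced by the `ℓ²` norm. -/
def HilbertCube : Set (lp (fun _ : ℕ => ℝ) 2) :=
  {x | ∀ i : ℕ, (x : ℕ → ℝ) i ∈ Set.Icc (0:ℝ) (1 / 2 ^ i)}

/-- Covering dimension of a topological space is at most `n` (as an integer, so that `n ≤ -1`
means the space is empty): every finite open cover admits an open shrinking of order `≤ n + 1`. -/
def CovDimLE (X : Type*) [TopologicalSpace X] (n : ℤ) : Prop :=
  ∀ (ι : Type) (U : ι → Set X), Finite ι → (∀ i, IsOpen (U i)) → (⋃ i, U i) = Set.univ →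
    ∃ V : ι → Set X, (∀ i, IsOpen (V i)) ∧ (∀ i, V i ⊆ U i) ∧ (⋃ i, V i) = Set.univ ∧
      ∀ x : X, (({i | x ∈ V i}).ncard : ℤ) ≤ n + 1

/-- A perfect map: continuous, closed, with compact fibers. -/
def IsPerfectMap {X Y : Type*} [TopologicalSpace X] [TopologicalSpace Y] (f : X → Y) : Prop :=
  Continuous f ∧ IsClosedMap f ∧ ∀ y : Y, IsCompact (f ⁻¹' {y})

/-- `f` has countable (functional) weight: there is a continuous `h : X → I^∞` such that the
diagonal product `f × h` embeds `X` into `Y × I^∞`. -/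
def HasCountableFunctionalWeight {X Y : Type*} [TopologicalSpace X] [TopologicalSpace Y]
    (f : X → Y) : Prop :=
  ∃ h : C(X, ↥HilbertCube), IsEmbedding (fun x => (f x, h x) : X → Y × ↥HilbertCube)

/-- `h` restricted to `A` is an `ω`-map: every point of `A` has a neighborhood `V` of its image
whose preimage within `A` is contained in some member of `ω`. -/
def IsOmegaMapOn {X Z : Type*} [TopologicalSpace X] [TopologicalSpace Z]
    (ω : Set (Set X)) (h : X → Z) (A : Set X) : Prop :=
  ∀ x ∈ A, ∃ V ∈ nhds (h x), ∃ W ∈ ω, A ∩ h ⁻¹' V ⊆ W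

/-- A set `U ⊆ C(X, M)` is open in the source limitation (fine) topology: every `g ∈ U` admits a
continuous `α : X → (0, ∞)` with `B̄(g, α) ⊆ U`. -/
def SLOpen {X M : Type*} [TopologicalSpace X] [PseudoMetricSpace M] (U : Set C(X, M)) : Prop :=
  ∀ g ∈ U, ∃ α : C(X, ℝ), (∀ x, 0 < α x) ∧
    {h : C(X, M) | ∀ x, dist (g x) (h x) ≤ α x} ⊆ U

/-- A set `D ⊆ C(X, M)` is dense in the source limitation topology. -/
def SLDense {X M : Type*} [TopologicalSpace X] [PseudoMetricSpace M] (D : Set C(X, M)) : Prop :=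
  ∀ U : Set C(X, M), SLOpen U → U.Nonempty → (U ∩ D).Nonempty

/-- A set `D ⊆ C(X, M)` is a `G_δ`-set in the source limitation topology. -/
def SLGdelta {X M : Type*} [TopologicalSpace X] [PseudoMetricSpace M] (D : Set C(X, M)) : Prop :=
  ∃ F : ℕ → Set C(X, M), (∀ i, SLOpen (F i)) ∧ D = ⋂ i, F i

/-- `Y` is a `C`-space: for every sequence `ω` of open covers there are pairwise disjoint open
families `γ i`, with `γ i` refining `ω i`, whose union covers `Y`. -/
def IsCSpace (Y : Type*) [TopologicalSpace Y] : Prop :=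
  ∀ ω : ℕ → Set (Set Y), (∀ i, ∀ U ∈ ω i, IsOpen U) → (∀ i, ⋃₀ ω i = Set.univ) →
    ∃ γ : ℕ → Set (Set Y),
      (∀ i, ∀ U ∈ γ i, IsOpen U) ∧
      (∀ i, (γ i).Pairwise Disjoint) ∧
      (∀ i, ∀ U ∈ γ i, ∃ W ∈ ω i, U ⊆ W) ∧
      ⋃₀ (⋃ i, γ i) = Set.univ

/-- A closed set `F` in a metric space `M` is a `Z_m`-set: the maps `I^m → M` avoiding `F` are
dense in the space of maps `I^m → M` with the uniform convergence (sup-metric) topology. -/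
def IsZSet {M : Type*} [PseudoMetricSpace M] (m : ℕ) (F : Set M) : Prop :=
  IsClosed F ∧ Dense {u : BoundedContinuousFunction ↥(cube m) M | ∀ z, u z ∉ F}

/-- A `σZ_m`-set: a countable union of closed `Z_m`-sets. -/
def IsSigmaZSet {M : Type*} [PseudoMetricSpace M] (m : ℕ) (S : Set M) : Prop :=
  ∃ F : ℕ → Set M, (∀ i, IsZSet m (F i)) ∧ S = ⋃ i, F i

/-- A `k`-plane in `ℝ^p`: the set where `p - k` fixed coordinates take fixed real values. -/
def IsPlane (p k : ℕ) (P : Set (EuclideanSpace ℝ (Fin p))) : Prop :=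
  ∃ (s : Finset (Fin p)) (r : Fin p → ℝ), s.card = p - k ∧
    P = {x | ∀ i ∈ s, x i = r i}

/-- A rational `k`-plane in `ℝ^p`: the fixed coordinate values are rational. -/
def IsRatPlane (p k : ℕ) (P : Set (EuclideanSpace ℝ (Fin p))) : Prop :=
  ∃ (s : Finset (Fin p)) (r : Fin p → ℚ), s.card = p - k ∧
    P = {x | ∀ i ∈ s, x i = (r i : ℝ)}

/-- Condition (R): `dim (g(f⁻¹(y)) ∩ Π) ≤ k - n - 1` for every `y ∈ Y` and every rational
`k`-plane `Π` in `ℝ^{2n+1+m}` with `0 ≤ k ≤ 2n`. -/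
def ConditionR {X Y : Type*} [TopologicalSpace X] [TopologicalSpace Y]
    (f : X → Y) (n m : ℕ) (g : X → ↥(cube (2*n+1+m))) : Prop :=
  ∀ y : Y, ∀ k : ℕ, k ≤ 2*n → ∀ P : Set (EuclideanSpace ℝ (Fin (2*n+1+m))),
    IsRatPlane (2*n+1+m) k P →
    CovDimLE ↥(((fun x => ((g x : EuclideanSpace ℝ (Fin (2*n+1+m))))) '' (f ⁻¹' {y})) ∩ P)
      ((k : ℤ) - n - 1)

/-- The restriction `f|B` is σ-perfect with countable weight: `B = ⋃ᵢ Bᵢ` with `Bᵢ ⊆ X` closed,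
`f(Bᵢ) ⊆ Y` closed, and each `f|Bᵢ : Bᵢ → f(Bᵢ)` a perfect map of countable weight. -/
def SigmaPerfectCW {X Y : Type*} [TopologicalSpace X] [TopologicalSpace Y]
    (f : X → Y) (B : Set X) : Prop :=
  ∃ Bi : ℕ → Set X, B = ⋃ i, Bi i ∧ ∀ i : ℕ,
    IsClosed (Bi i) ∧ IsClosed (f '' Bi i) ∧
    IsPerfectMap ((Set.mapsTo_image f (Bi i)).restrict f (Bi i) (f '' Bi i)) ∧
    HasCountableFunctionalWeight ((Set.mapsTo_image f (Bi i)).restrict f (Bi i) (f '' Bi i))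

/-- Ostrand-type colouring: every open cover of a paracompact space is refined by countably many
locally constant families. -/
lemma ostrand_aux {Y ι : Type*} [TopologicalSpace Y] [T2Space Y] [ParacompactSpace Y]
    (U : ι → Set Y) (hU : ∀ i, IsOpen (U i)) (hc : (⋃ i, U i) = Set.univ) :
    ∃ (O : ℕ → Set Y) (s : ℕ → Y → ι), (∀ k, IsOpen (O k)) ∧ (⋃ k, O k) = Set.univ ∧
      (∀ k, ∀ y ∈ O k, y ∈ U (s k y) ∧ ∀ᶠ z in 𝓝 y, s k z = s k y) ∧
      ∀ k, ∀ y ∈ O k, ∃ σ : Finset ι, σ.card = k + 1 ∧ ∀ i ∈ σ, y ∈ U i := by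
  classical
  rcases isEmpty_or_nonempty Y with hY | ⟨⟨y0⟩⟩
  · exact ⟨fun _ => ∅, fun _ y => (hY.false y).elim, fun _ => isOpen_empty,
      Set.eq_univ_of_forall fun y => (hY.false y).elim, fun _ y => (hY.false y).elim,
      fun _ y => (hY.false y).elim⟩
  have hι : Nonempty ι := by
    have : y0 ∈ ⋃ i, U i := hc ▸ mem_univ _
    obtain ⟨i, _⟩ := mem_iUnion.1 this
    exact ⟨i⟩
  obtain ⟨ρ, hρ⟩ := PartitionOfUnity.exists_isSubordinate isClosed_univ U hU hc.ge
  have hρU : ∀ i y, 0 < ρ i y → y ∈ U i := fun i y h =>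
    hρ i (subset_tsupport _ (by simpa using h.ne'))
  let V : Finset ι → Set Y := fun σ =>
    {y | (∀ i ∈ σ, 0 < ρ i y) ∧ ∀ i ∈ σ, ∀ j ∉ σ, ρ j y < ρ i y}
  have hVopen : ∀ σ, IsOpen (V σ) := by
    intro σ
    rw [isOpen_iff_mem_nhds]
    rintro y ⟨h1, h2⟩
    obtain ⟨N, hN, hfin⟩ := ρ.locallyFinite y
    have e1 : ∀ᶠ z in 𝓝 y, ∀ i ∈ σ, 0 < ρ i z := by
      rw [Filter.eventually_all_finset]
      intro i hi
      exact (ρ i).continuous.continuousAt.eventually (lt_mem_nhds (h1 i hi))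
    have e2 : ∀ᶠ z in 𝓝 y, ∀ i ∈ σ, ∀ j ∈ hfin.toFinset, j ∉ σ → ρ j z < ρ i z := by
      rw [Filter.eventually_all_finset]
      intro i hi
      rw [Filter.eventually_all_finset]
      intro j _
      by_cases hj : j ∈ σ
      · exact Filter.Eventually.of_forall fun z h => (h hj).elim
      · have := (((ρ i).continuous.sub (ρ j).continuous).continuousAt (x := y)).eventually
          (lt_mem_nhds (sub_pos.2 (h2 i hi j hj)))
        filter_upwards [this] with z hz _
        exact sub_pos.1 hz
    filter_upwards [e1, e2, hN] with z hz1 hz2 hzN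
    refine ⟨hz1, fun i hi j hj => ?_⟩
    by_cases hjf : j ∈ hfin.toFinset
    · exact hz2 i hi j hjf hj
    · have : ρ j z = 0 := by
        by_contra hne
        exact hjf (by simpa using ⟨z, hne, hzN⟩)
      rw [this]; exact hz1 i hi
  have hVuniq : ∀ σ τ : Finset ι, σ.card = τ.card → ∀ y, y ∈ V σ → y ∈ V τ → σ = τ := by
    intro σ τ hcard y hσ hτ
    by_contra hne
    have h1 : ¬ σ ⊆ τ := fun h => hne (Finset.eq_of_subset_of_card_le h hcard.ge)
    have h2 : ¬ τ ⊆ σ := fun h => hne (Finset.eq_of_subset_of_card_le h hcard.le).symm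
    obtain ⟨i, hi, hi'⟩ := Finset.not_subset.1 h1
    obtain ⟨j, hj, hj'⟩ := Finset.not_subset.1 h2
    exact lt_asymm (hσ.2 i hi j hj') (hτ.2 j hj i hi')
  have hpick : ∀ σ : Finset ι, ∃ i, σ.Nonempty → i ∈ σ := by
    intro σ
    by_cases h : σ.Nonempty
    · exact ⟨h.choose, fun _ => h.choose_spec⟩
    · exact ⟨hι.some, fun h' => (h h').elim⟩
  choose pick hpick using hpick
  let σf : ℕ → Y → Finset ι := fun k y =>
    if h : ∃ σ : Finset ι, σ.card = k + 1 ∧ y ∈ V σ then h.choose else ∅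
  have hσf : ∀ k y σ, σ.card = k + 1 → y ∈ V σ → σf k y = σ := by
    intro k y σ h1 h2
    have h : ∃ σ : Finset ι, σ.card = k + 1 ∧ y ∈ V σ := ⟨σ, h1, h2⟩
    have : σf k y = h.choose := dif_pos h
    rw [this]
    exact hVuniq _ _ (h.choose_spec.1.trans h1.symm) y h.choose_spec.2 h2
  refine ⟨fun k => ⋃ σ : {σ : Finset ι // σ.card = k + 1}, V σ, fun k y => pick (σf k y),
    fun k => isOpen_iUnion fun σ => hVopen σ, ?_, ?_, ?_⟩
  · refine Set.eq_univ_of_forall fun y => ?_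
    have hfin := ρ.locallyFinite.point_finite y
    obtain ⟨i0, hi0⟩ := ρ.exists_pos (mem_univ y)
    have hpos : 0 < hfin.toFinset.card :=
      Finset.card_pos.2 ⟨i0, by simpa using hi0.ne'⟩
    refine mem_iUnion.2 ⟨hfin.toFinset.card - 1, mem_iUnion.2 ⟨⟨hfin.toFinset, by omega⟩, ?_, ?_⟩⟩
    · intro i hi
      have : ρ i y ≠ 0 := by simpa using hi
      exact lt_of_le_of_ne (ρ.nonneg i y) this.symm
    · intro i hi j hj
      have h1 : ρ i y ≠ 0 := by simpa using hi
      have h2 : ρ j y = 0 := by simpa using hj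
      rw [h2]
      exact lt_of_le_of_ne (ρ.nonneg i y) h1.symm
  · intro k y hy
    obtain ⟨⟨σ, hσ⟩, hyσ⟩ := mem_iUnion.1 hy
    have h1 := hσf k y σ hσ hyσ
    have hne : σ.Nonempty := Finset.card_pos.1 (by omega)
    refine ⟨?_, ?_⟩
    · show y ∈ U (pick (σf k y))
      rw [h1]
      exact hρU _ _ (hyσ.1 _ (hpick σ hne))
    · filter_upwards [(hVopen σ).mem_nhds hyσ] with z hz
      rw [h1, hσf k z σ hσ hz]
  · intro k y hy
    obtain ⟨⟨σ, hσ⟩, hyσ⟩ := mem_iUnion.1 hy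
    exact ⟨σ, hσ, fun i hi => hρU _ _ (hyσ.1 i hi)⟩

/-- One step in the construction of shrinkings of countable covers. -/
lemma shrink_step {Y : Type*} [TopologicalSpace Y] (m : ℕ) (hdim : CovDimLE Y m)
    (φ : Y → ℝ) (hφ : Continuous φ) (k : ℕ) (A : ℕ → Set Y) (hA : ∀ i, IsOpen (A i))
    (hAc : (⋃ i, A i) = Set.univ) (hAφ : ∀ i, ∀ y ∈ A i, (i : ℝ) < φ y)
    (hord : ∀ y, φ y < k → ∀ σ : Finset ℕ, (∀ i ∈ σ, y ∈ A i) → σ.card ≤ m + 1) :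
    ∃ B : ℕ → Set Y, (∀ i, IsOpen (B i)) ∧ (⋃ i, B i) = Set.univ ∧ (∀ i, B i ⊆ A i) ∧
      (∀ i, ∀ y, φ y < k → y ∈ A i → y ∈ B i) ∧
      (∀ y, φ y < (k + 1 : ℕ) → ∀ σ : Finset ℕ, (∀ i ∈ σ, y ∈ B i) → σ.card ≤ m + 1) := by
  classical
  let C : Option (Fin (k + 1)) → Set Y := fun o =>
    o.elim (⋃ i : {i : ℕ // k < i}, A i) (fun j => A j)
  have hC : ∀ o, IsOpen (C o) := by
    rintro (_ | j)
    · exact isOpen_iUnion fun i => hA i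
    · exact hA j
  have hCc : (⋃ o, C o) = Set.univ := by
    refine Set.eq_univ_of_forall fun y => ?_
    have : y ∈ ⋃ i, A i := hAc ▸ mem_univ y
    obtain ⟨i, hi⟩ := mem_iUnion.1 this
    by_cases h : k < i
    · exact mem_iUnion.2 ⟨none, mem_iUnion.2 ⟨⟨i, h⟩, hi⟩⟩
    · exact mem_iUnion.2 ⟨some ⟨i, by omega⟩, hi⟩
  obtain ⟨V, hVo, hVs, hVc, hVord⟩ := hdim _ C inferInstance hC hCc
  let V' : ℕ → Set Y := fun i => if h : i < k + 1 then V (some ⟨i, h⟩) else V none ∩ A i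
  have hV'o : ∀ i, IsOpen (V' i) := by
    intro i
    by_cases h : i < k + 1
    · simp only [V', h, dif_pos]; exact hVo _
    · simp only [V', h, dif_neg, not_false_iff]; exact (hVo _).inter (hA i)
  have hV's : ∀ i, V' i ⊆ A i := by
    intro i
    by_cases h : i < k + 1
    · simp only [V', h, dif_pos]; exact hVs (some ⟨i, h⟩)
    · simp only [V', h, dif_neg, not_false_iff]; exact inter_subset_right
  have hV'c : ∀ y, ∃ i, y ∈ V' i := by
    intro y
    have : y ∈ ⋃ o, V o := hVc ▸ mem_univ y
    obtain ⟨o, ho⟩ := mem_iUnion.1 this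
    rcases o with _ | j
    · have := hVs _ ho
      obtain ⟨⟨i, hi⟩, hyi⟩ := mem_iUnion.1 this
      refine ⟨i, ?_⟩
      have h : ¬ i < k + 1 := by omega
      simp only [V', h, dif_neg, not_false_iff]
      exact ⟨ho, hyi⟩
    · refine ⟨j, ?_⟩
      simp only [V', j.2, dif_pos]; exact ho
  refine ⟨fun i => (A i ∩ {y | φ y < k}) ∪ (V' i ∩ {y | (k : ℝ) - 1 < φ y}), ?_, ?_, ?_, ?_, ?_⟩
  · intro i
    exact ((hA i).inter (isOpen_lt hφ continuous_const)).union
      ((hV'o i).inter (isOpen_lt continuous_const hφ))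
  · refine Set.eq_univ_of_forall fun y => ?_
    by_cases h : φ y < k
    · have : y ∈ ⋃ i, A i := hAc ▸ mem_univ y
      obtain ⟨i, hi⟩ := mem_iUnion.1 this
      exact mem_iUnion.2 ⟨i, Or.inl ⟨hi, h⟩⟩
    · obtain ⟨i, hi⟩ := hV'c y
      refine mem_iUnion.2 ⟨i, Or.inr ⟨hi, ?_⟩⟩
      show (k : ℝ) - 1 < φ y
      linarith [not_lt.1 h]
  · rintro i y (h | h)
    · exact h.1
    · exact hV's i h.1
  · intro i y h1 h2
    exact Or.inl ⟨h2, h1⟩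
  · intro y hy σ hσ
    by_cases h : φ y < k
    · refine hord y h σ fun i hi => ?_
      rcases hσ i hi with h' | h'
      · exact h'.1
      · exact hV's i h'.1
    · have hσ' : ∀ i ∈ σ, ∃ hi : i < k + 1, y ∈ V (some ⟨i, hi⟩) := by
        intro i hi
        rcases hσ i hi with h' | h'
        · exact (h h'.2).elim
        · have hlt : i < k + 1 := by
            have := (hAφ i y (hV's i h'.1)).trans hy
            exact_mod_cast this
          refine ⟨hlt, ?_⟩
          have := h'.1
          simpa only [V', hlt, dif_pos] using this
      have hle : ((σ.attach.image (fun i => (some ⟨i.1, (hσ' i.1 i.2).1⟩ : Option (Fin (k+1))))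
          : Finset (Option (Fin (k+1)))) : Set (Option (Fin (k+1)))).ncard ≤ {o | y ∈ V o}.ncard := by
        refine Set.ncard_le_ncard ?_ (Set.toFinite _)
        intro o ho
        simp only [Finset.coe_image, Set.mem_image] at ho
        obtain ⟨i, _, rfl⟩ := ho
        exact (hσ' i.1 i.2).2
      rw [Set.ncard_coe_finset, Finset.card_image_of_injective, Finset.card_attach] at hle
      · have := hVord y
        omega
      · intro i j hij
        simp only [Option.some.injEq, Fin.mk.injEq] at hij
        exact Subtype.ext hij

/-- Countable open covers of a paracompact space of dimension `≤ m` have open shrinkings of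
order `≤ m + 1`. -/
lemma countable_shrink {Y : Type*} [TopologicalSpace Y] [T2Space Y] [ParacompactSpace Y]
    (m : ℕ) (hdim : CovDimLE Y m) (U : ℕ → Set Y) (hU : ∀ i, IsOpen (U i))
    (hc : (⋃ i, U i) = Set.univ) :
    ∃ V : ℕ → Set Y, (∀ i, IsOpen (V i)) ∧ (⋃ i, V i) = Set.univ ∧ (∀ i, V i ⊆ U i) ∧
      ∀ y, ∀ σ : Finset ℕ, (∀ i ∈ σ, y ∈ V i) → σ.card ≤ m + 1 := by
  classical
  obtain ⟨ρ, hρ⟩ := PartitionOfUnity.exists_isSubordinate isClosed_univ U hU hc.ge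
  have hρU : ∀ i y, 0 < ρ i y → y ∈ U i := fun i y h =>
    hρ i (subset_tsupport _ (by simpa using h.ne'))
  let φ : Y → ℝ := fun y => ∑ᶠ i, ρ i y • ((i : ℝ) + 1)
  have hφ : Continuous φ :=
    ρ.continuous_finsum_smul (g := fun i _ => (i : ℝ) + 1) fun i y _ => continuousAt_const
  have hex : ∀ y, ∃ i, 0 < ρ i y ∧ (i : ℝ) < φ y := by
    intro y
    by_contra hcon
    push Not at hcon
    have hfin := ρ.locallyFinite.point_finite y
    have e1 : φ y = ∑ i ∈ hfin.toFinset, ρ i y * ((i : ℝ) + 1) := by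
      apply finsum_eq_sum_of_support_subset
      intro i hi
      simp only [Function.mem_support, smul_eq_mul] at hi
      simpa using left_ne_zero_of_mul hi
    have e2 : (1 : ℝ) = ∑ i ∈ hfin.toFinset, ρ i y := by
      rw [← ρ.sum_eq_one (mem_univ y)]
      apply finsum_eq_sum_of_support_subset
      intro i hi
      simpa using hi
    have e3 : ∑ i ∈ hfin.toFinset, ρ i y * (φ y + 1) ≤ ∑ i ∈ hfin.toFinset, ρ i y * ((i : ℝ) + 1) := by
      refine Finset.sum_le_sum fun i hi => ?_
      have h1 : ρ i y ≠ 0 := by simpa using hi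
      have h2 : 0 < ρ i y := lt_of_le_of_ne (ρ.nonneg i y) h1.symm
      have := hcon i h2
      gcongr
    rw [← Finset.sum_mul, ← e2, ← e1] at e3
    linarith
  let P : ℕ → (ℕ → Set Y) → Prop := fun k A => (∀ i, IsOpen (A i)) ∧ (⋃ i, A i) = Set.univ ∧
    (∀ i, A i ⊆ U i) ∧ (∀ i, ∀ y ∈ A i, (i : ℝ) < φ y) ∧
    (∀ y, φ y < k → ∀ σ : Finset ℕ, (∀ i ∈ σ, y ∈ A i) → σ.card ≤ m + 1)
  have h0 : P 0 (fun i => U i ∩ {y | (i : ℝ) < φ y}) := by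
    refine ⟨fun i => (hU i).inter (isOpen_lt continuous_const hφ), ?_, fun i => inter_subset_left,
      fun i y hy => hy.2, ?_⟩
    · refine Set.eq_univ_of_forall fun y => ?_
      obtain ⟨i, h1, h2⟩ := hex y
      exact mem_iUnion.2 ⟨i, hρU i y h1, h2⟩
    · intro y hy
      obtain ⟨i, h1, h2⟩ := hex y
      have : (0 : ℝ) ≤ i := Nat.cast_nonneg i
      simp only [Nat.cast_zero] at hy
      linarith
  have hstep : ∀ k A, P k A → ∃ B, P (k + 1) B ∧ (∀ i, B i ⊆ A i) ∧
      (∀ i, ∀ y, φ y < k → y ∈ A i → y ∈ B i) := by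
    rintro k A ⟨a1, a2, a3, a4, a5⟩
    obtain ⟨B, b1, b2, b3, b4, b5⟩ := shrink_step m hdim φ hφ k A a1 a2 a4 a5
    exact ⟨B, ⟨b1, b2, fun i => (b3 i).trans (a3 i), fun i y hy => a4 i y (b3 i hy), b5⟩, b3, b4⟩
  choose! nxt hn1 hn2 hn3 using hstep
  let S : ℕ → ℕ → Set Y := fun k => Nat.rec (fun i => U i ∩ {y | (i : ℝ) < φ y}) (fun k A => nxt k A) k
  have hS : ∀ k, P k (S k) := by
    intro k
    induction k with
    | zero => exact h0
    | succ k ih => exact hn1 k _ ih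
  have hS1 : ∀ k i, S (k + 1) i ⊆ S k i := fun k i => hn2 k _ (hS k) i
  have hS2 : ∀ (k : ℕ) i y, φ y < k → y ∈ S k i → y ∈ S (k + 1) i := fun k i y => hn3 k _ (hS k) i y
  have hanti : ∀ k l, k ≤ l → ∀ i, S l i ⊆ S k i := by
    intro k l hkl i
    induction l, hkl using Nat.le_induction with
    | base => exact subset_rfl
    | succ l _ ih => exact (hS1 l i).trans ih
  have hmono : ∀ k l : ℕ, k ≤ l → ∀ i y, φ y < k → y ∈ S k i → y ∈ S l i := by
    intro k l hkl i y hy h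
    induction l, hkl using Nat.le_induction with
    | base => exact h
    | succ l hkl ih => exact hS2 l i y (hy.trans_le (by exact_mod_cast hkl)) ih
  refine ⟨fun i => ⋃ k : ℕ, S k i ∩ {y | φ y < k}, ?_, ?_, ?_, ?_⟩
  · intro i
    exact isOpen_iUnion fun k => ((hS k).1 i).inter (isOpen_lt hφ continuous_const)
  · refine Set.eq_univ_of_forall fun y => ?_
    obtain ⟨k, hk⟩ := exists_nat_gt (φ y)
    have : y ∈ ⋃ i, S k i := (hS k).2.1 ▸ mem_univ y
    obtain ⟨i, hi⟩ := mem_iUnion.1 this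
    exact mem_iUnion.2 ⟨i, mem_iUnion.2 ⟨k, hi, hk⟩⟩
  · intro i y hy
    obtain ⟨k, hk, _⟩ := mem_iUnion.1 hy
    exact (hS k).2.2.1 i hk
  · intro y σ hσ
    obtain ⟨k, hk⟩ := exists_nat_gt (φ y)
    refine (hS k).2.2.2.2 y hk σ fun i hi => ?_
    obtain ⟨l, hl, hl'⟩ := mem_iUnion.1 (hσ i hi)
    rcases le_total k l with h | h
    · exact hanti k l h i hl
    · exact hmono l k h i y hl' hl

/-- Ostrand's theorem in the form we need. -/
lemma ostrand {Y ι : Type*} [TopologicalSpace Y] [T2Space Y] [ParacompactSpace Y]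
    (m : ℕ) (hdim : CovDimLE Y m)
    (U : ι → Set Y) (hU : ∀ i, IsOpen (U i)) (hc : (⋃ i, U i) = Set.univ) :
    ∃ (O : Fin (m + 1) → Set Y) (s : Fin (m + 1) → Y → ι), (∀ k, IsOpen (O k)) ∧
      (⋃ k, O k) = Set.univ ∧
      (∀ k, ∀ y ∈ O k, y ∈ U (s k y) ∧ ∀ᶠ z in 𝓝 y, s k z = s k y) := by
  obtain ⟨O1, s1, h1o, h1c, h1s, -⟩ := ostrand_aux U hU hc
  obtain ⟨V, hVo, hVc, hVs, hVord⟩ := countable_shrink m hdim O1 h1o h1c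
  obtain ⟨O2, s2, h2o, h2c, h2s, h2ord⟩ := ostrand_aux V hVo hVc
  refine ⟨fun k => O2 k, fun k y => s1 (s2 k y) y, fun k => h2o k, ?_, ?_⟩
  · refine Set.eq_univ_of_forall fun y => ?_
    have : y ∈ ⋃ k, O2 k := h2c ▸ mem_univ y
    obtain ⟨k, hk⟩ := mem_iUnion.1 this
    obtain ⟨σ, hσ, hσ'⟩ := h2ord k y hk
    have := hVord y σ hσ'
    exact mem_iUnion.2 ⟨⟨k, by omega⟩, hk⟩
  · intro k y hy
    obtain ⟨ha, hb⟩ := h2s k y hy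
    obtain ⟨hc, hd⟩ := h1s _ y (hVs _ ha)
    refine ⟨hc, ?_⟩
    filter_upwards [hb, hd] with z hz1 hz2
    rw [hz1, hz2]

/-- Iterated homotopies along a chain. -/
def chainU {Y E : Type*} [Zero E] (H : ℕ → Y → E × ℝ → E) (c : ℕ → Y) (θ : ℕ → ℝ) : ℕ → E
  | 0 => 0
  | i + 1 => H i (c i) (chainU H c θ i, θ i)

lemma chainU_congr {Y E : Type*} [Zero E] {H H' : ℕ → Y → E × ℝ → E} {c c' : ℕ → Y}
    {θ θ' : ℕ → ℝ} (i : ℕ)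
    (h : ∀ k < i, ∀ e, H k (c k) (e, θ k) = H' k (c' k) (e, θ' k)) :
    chainU H c θ i = chainU H' c' θ' i := by
  induction i with
  | zero => rfl
  | succ i ih =>
    simp only [chainU]
    rw [ih fun k hk => h k (by omega), h i (by omega)]

lemma chainU_lipschitz {Y E Z : Type*} [NormedAddCommGroup E] [PseudoEMetricSpace Z]
    (H : ℕ → Y → E × ℝ → E) (c : ℕ → Y) (θ : Z → ℕ → ℝ) (i : ℕ)
    (hH : ∀ k < i, LocallyLipschitz (H k (c k)))
    (hθ : ∀ k < i, LocallyLipschitz fun z => θ z k) :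
    LocallyLipschitz fun z => chainU H c (θ z) i := by
  induction i with
  | zero => exact (LipschitzWith.const (0 : E)).locallyLipschitz
  | succ i ih =>
    have h1 := ih (fun k hk => hH k (by omega)) (fun k hk => hθ k (by omega))
    exact (hH i (by omega)).comp (h1.prodMk (hθ i (by omega)))

lemma chainU_continuousAt {Y E Z : Type*} [NormedAddCommGroup E] [TopologicalSpace Z]
    (H : ℕ → Y → E × ℝ → E) (c : ℕ → Y) (θ : Z → ℕ → ℝ) (i : ℕ) (z : Z)
    (hH : ∀ k < i, Continuous (H k (c k)))
    (hθ : ∀ k < i, ContinuousAt (fun z => θ z k) z) :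
    ContinuousAt (fun z => chainU H c (θ z) i) z := by
  induction i with
  | zero => exact continuousAt_const
  | succ i ih =>
    have h1 := ih (fun k hk => hH k (by omega)) (fun k hk => hθ k (by omega))
    exact ((hH i (by omega)).continuousAt).comp (h1.prodMk (hθ i (by omega)))

/-- The contractibility condition on the fibre `Φ_y`. -/
def FibreContr {E : Type*} [NormedAddCommGroup E] (m : ℕ) (Φ : Set E) : Prop :=
  ∀ (N : ℕ) (j : Fin N → Fin m) (φ : Fin N → (Fin m → ℝ) → E), (∀ c, LocallyLipschitz (φ c)) →
    (∀ c z t, φ c (Function.update z (j c) t) = φ c z) →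
    (∀ c z, (∀ i, z i ∈ Icc (0 : ℝ) 1) → φ c z ∈ Φ) →
    ∃ H : E × ℝ → E, LocallyLipschitz H ∧ (∀ e, H (e, 0) = e) ∧ (∃ e1 ∈ Φ, ∀ e, H (e, 1) = e1) ∧
      ∀ c z, (∀ i, z i ∈ Icc (0 : ℝ) 1) → ∀ t ∈ Icc (0 : ℝ) 1, H (φ c z, t) ∈ Φ

/-- The data at level `i`. -/
structure LevelOK {Y E : Type*} [TopologicalSpace Y] [NormedAddCommGroup E] (Φ : Set (Y × E))
    (W : ℕ → Y → Set Y) (H : ℕ → Y → E × ℝ → E) (i : ℕ) : Prop where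
  isOpen : ∀ s, IsOpen (W i s)
  cover : ∀ y, ∃ s, y ∈ W i s
  lf : LocallyFinite (W i)
  lip : ∀ s, LocallyLipschitz (H i s)
  zero : ∀ s e, H i s (e, 0) = e
  good : ∀ y (c : ℕ → Y) (θ : ℕ → ℝ), (∀ k < i + 1, y ∈ closure (W k (c k))) →
    (∀ k, θ k ∈ Icc (0 : ℝ) 1) → (∃ k < i + 1, θ k = 1) → (y, chainU H c θ (i + 1)) ∈ Φ

lemma level_step {Y E : Type*} [TopologicalSpace Y] [T2Space Y] [ParacompactSpace Y]
    [NormedAddCommGroup E] (m : ℕ) (Φ : Set (Y × E)) (hΦ : IsOpen Φ)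
    (hc : ∀ y, FibreContr m {e | (y, e) ∈ Φ})
    (W : ℕ → Y → Set Y) (H : ℕ → Y → E × ℝ → E) (i : ℕ) (hi : i ≤ m)
    (hL : ∀ k < i, LevelOK Φ W H k) :
    ∃ (Wi : Y → Set Y) (Hi : Y → E × ℝ → E),
      (∀ s, IsOpen (Wi s)) ∧ (∀ y, ∃ s, y ∈ Wi s) ∧ LocallyFinite Wi ∧
      (∀ s, LocallyLipschitz (Hi s)) ∧ (∀ s e, Hi s (e, 0) = e) ∧
      ∀ y (c : ℕ → Y) (θ : ℕ → ℝ), (∀ k < i, y ∈ closure (W k (c k))) → y ∈ closure (Wi (c i)) →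
        (∀ k, θ k ∈ Icc (0 : ℝ) 1) → (∃ k < i + 1, θ k = 1) →
        (y, Hi (c i) (chainU H c θ i, θ i)) ∈ Φ := by
  classical
  -- the local construction
  have hloc : ∀ s : Y, ∃ (Hs : E × ℝ → E) (O : Set Y), LocallyLipschitz Hs ∧ (∀ e, Hs (e, 0) = e) ∧
      IsOpen O ∧ s ∈ O ∧
      ∀ y ∈ O, ∀ (c : ℕ → Y) (θ : ℕ → ℝ), (∀ k < i, y ∈ closure (W k (c k))) →
        (∀ k, θ k ∈ Icc (0 : ℝ) 1) → (∃ k < i + 1, θ k = 1) →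
        (y, Hs (chainU H c θ i, θ i)) ∈ Φ := by
    intro s
    let J : Set ((Fin i → Y) × Fin i) := {q | ∀ k : Fin i, s ∈ closure (W k (q.1 k))}
    have hJfin : J.Finite := by
      have h1 : {c : Fin i → Y | ∀ k : Fin i, s ∈ closure (W k (c k))}.Finite :=
        Set.Finite.pi' fun k : Fin i => (hL k k.2).lf.closure.point_finite s
      exact (h1.prod (Set.finite_univ (α := Fin i))).subset fun q hq => ⟨hq, mem_univ _⟩
    have : Finite J := hJfin
    obtain ⟨N, ⟨eqv⟩⟩ := Finite.exists_equiv_fin J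
    let θf : Fin i → (Fin m → ℝ) → ℕ → ℝ := fun j z k =>
      if k = j then 1 else if h : k < m then z ⟨k, h⟩ else 0
    let cf : (Fin i → Y) → ℕ → Y := fun c k => if h : k < i then c ⟨k, h⟩ else s
    let ψ : (Fin i → Y) × Fin i → (Fin m → ℝ) → E := fun q z => chainU H (cf q.1) (θf q.2 z) i
    have hψlip : ∀ q, LocallyLipschitz (ψ q) := by
      intro q
      apply chainU_lipschitz
      · intro k hk
        exact (hL k hk).lip _
      · intro k hk
        by_cases h1 : k = q.2
        · simp only [θf, h1, if_true]
          exact (LipschitzWith.const (1 : ℝ)).locallyLipschitz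
        · have h2 : k < m := by omega
          simp only [θf, h1, if_false, h2, dif_pos]
          exact (LipschitzWith.eval (⟨k, h2⟩ : Fin m)).locallyLipschitz
    have hθI : ∀ j z, (∀ i, z i ∈ Icc (0 : ℝ) 1) → ∀ k, θf j z k ∈ Icc (0 : ℝ) 1 := by
      intro j z hz k
      simp only [θf]
      split_ifs with h1 h2
      · exact ⟨zero_le_one, le_rfl⟩
      · exact hz _
      · exact ⟨le_rfl, zero_le_one⟩
    have hψΦ : ∀ q ∈ J, ∀ z, (∀ i, z i ∈ Icc (0 : ℝ) 1) → (s, ψ q z) ∈ Φ := by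
      rintro ⟨c, j⟩ hq z hz
      have hipos : 0 < i := by have := j.2; omega
      obtain ⟨i', rfl⟩ : ∃ i', i = i' + 1 := ⟨i - 1, by omega⟩
      apply (hL i' (by omega)).good s (cf c) (θf j z)
      · intro k hk
        have : cf c k = c ⟨k, hk⟩ := dif_pos hk
        rw [this]
        exact hq ⟨k, hk⟩
      · exact hθI j z hz
      · exact ⟨j, j.2, by simp [θf]⟩
    obtain ⟨Hs, hs1, hs2, ⟨e1, he1, he1'⟩, hs3⟩ := hc s N
      (fun a => Fin.castLE hi (eqv.symm a).1.2) (fun a => ψ (eqv.symm a).1)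
      (fun a => hψlip _)
      (by
        intro a z t
        apply chainU_congr
        intro k hk e
        congr 2
        simp only [θf]
        split_ifs with h1 h2
        · rfl
        · rw [Function.update_of_ne]
          intro h
          apply h1
          have := congrArg Fin.val h
          simpa using this
        · rfl)
      (fun a z hz => hψΦ _ (eqv.symm a).2 z hz)
    have ev1 : ∀ᶠ y in 𝓝 s, ∀ a : Fin N, ∀ p ∈ (Set.univ.pi fun _ : Fin m => Icc (0 : ℝ) 1) ×ˢ Icc (0 : ℝ) 1,
        (y, Hs (ψ (eqv.symm a).1 p.1, p.2)) ∈ Φ := by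
      rw [Filter.eventually_all]
      intro a
      refine IsCompact.eventually_forall_of_forall_eventually
        ((isCompact_univ_pi fun _ => isCompact_Icc).prod isCompact_Icc)
        (P := fun y p => (y, Hs (ψ (eqv.symm a).1 p.1, p.2)) ∈ Φ) ?_
      rintro ⟨z, t⟩ ⟨hz, ht⟩
      have hcont : Continuous fun w : Y × ((Fin m → ℝ) × ℝ) =>
          (w.1, Hs (ψ (eqv.symm a).1 w.2.1, w.2.2)) := by
        have c1 := hs1.continuous
        have c2 := (hψlip (eqv.symm a).1).continuous
        fun_prop
      exact hcont.continuousAt.eventually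
        (hΦ.mem_nhds (hs3 a z (fun i => hz i (mem_univ i)) t ht))
    have ev2 : ∀ᶠ y in 𝓝 s, ∀ k : Fin i, {r | y ∈ closure (W k r)} ⊆ {r | s ∈ closure (W k r)} := by
      rw [Filter.eventually_all]
      intro k
      exact (hL k k.2).lf.closure.eventually_subset (fun _ => isClosed_closure) s
    have ev3 : ∀ᶠ y in 𝓝 s, (y, e1) ∈ Φ := by
      have hcont : Continuous fun y : Y => (y, e1) := by fun_prop
      exact hcont.continuousAt.eventually (hΦ.mem_nhds he1)
    obtain ⟨O, hO, hOo, hsO⟩ := eventually_nhds_iff.1 (ev1.and (ev2.and ev3))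
    refine ⟨Hs, O, hs1, hs2, hOo, hsO, ?_⟩
    intro y hy c θ hcl hθ hex
    obtain ⟨h1, h2, h3⟩ := hO y hy
    by_cases hθi : θ i = 1
    · rw [hθi, he1']; exact h3
    · obtain ⟨k, hk, hθk⟩ := hex
      have hki : k < i := by
        rcases Nat.lt_succ_iff_lt_or_eq.1 hk with h | h
        · exact h
        · exact (hθi (h ▸ hθk)).elim
      let q : J := ⟨(fun k => c k, ⟨k, hki⟩), fun l => h2 l (hcl l l.2)⟩
      have hψq : ψ q.1 (fun l => θ l) = chainU H c θ i := by
        apply chainU_congr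
        intro l hl e
        have e1 : cf q.1.1 l = c l := dif_pos hl
        have e2 : θf q.1.2 (fun l => θ l) l = θ l := by
          simp only [θf, q]
          split_ifs with h1 h2
          · rw [h1, hθk]
          · rfl
          · omega
        rw [e1, e2]
      have := h1 (eqv q) ((fun l => θ l), θ i) ⟨fun l _ => hθ l, hθ i⟩
      simp only [Equiv.symm_apply_apply] at this
      rwa [hψq] at this
  choose Hs O hs1 hs2 hs3 hs4 hs5 using hloc
  obtain ⟨V, hV1, hV2, hV3, hV4⟩ := precise_refinement O hs3
    (Set.eq_univ_of_forall fun y => mem_iUnion.2 ⟨y, hs4 y⟩)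
  obtain ⟨V', hV'1, hV'2, hV'3⟩ := exists_iUnion_eq_closure_subset hV1 hV3.point_finite hV2
  refine ⟨V', Hs, hV'2, ?_, hV3.subset fun s => subset_closure.trans (hV'3 s), hs1, hs2, ?_⟩
  · intro y
    exact mem_iUnion.1 (hV'1 ▸ mem_univ y)
  · intro y c θ h1 h2 h3 h4
    exact hs5 (c i) y (hV4 _ (hV'3 _ h2)) c θ h1 h3 h4

lemma levels_exist {Y E : Type*} [TopologicalSpace Y] [T2Space Y] [ParacompactSpace Y]
    [NormedAddCommGroup E] (m : ℕ) (Φ : Set (Y × E)) (hΦ : IsOpen Φ)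
    (hc : ∀ y, FibreContr m {e | (y, e) ∈ Φ}) (i : ℕ) (hi : i ≤ m + 1) :
    ∃ (W : ℕ → Y → Set Y) (H : ℕ → Y → E × ℝ → E), ∀ k < i, LevelOK Φ W H k := by
  induction i with
  | zero => exact ⟨fun _ _ => ∅, fun _ _ _ => 0, fun k hk => by omega⟩
  | succ i ih =>
    obtain ⟨W, H, hL⟩ := ih (by omega)
    obtain ⟨Wi, Hi, h1, h2, h3, h4, h5, h6⟩ := level_step m Φ hΦ hc W H i (by omega) hL
    have eW : ∀ k, k < i → Function.update W i Wi k = W k := fun k hk =>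
      Function.update_of_ne hk.ne _ _
    have eH : ∀ k, k < i → Function.update H i Hi k = H k := fun k hk =>
      Function.update_of_ne hk.ne _ _
    have eWi : Function.update W i Wi i = Wi := Function.update_self _ _ _
    have eHi : Function.update H i Hi i = Hi := Function.update_self _ _ _
    have eU : ∀ c θ l, l ≤ i → chainU (Function.update H i Hi) c θ l = chainU H c θ l := by
      intro c θ l hl
      apply chainU_congr
      intro k hk e
      rw [eH k (by omega)]
    refine ⟨Function.update W i Wi, Function.update H i Hi, fun k hk => ?_⟩
    rcases Nat.lt_succ_iff_lt_or_eq.1 hk with hki | rfl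
    · have hk' := hL k hki
      refine ⟨?_, ?_, ?_, ?_, ?_, ?_⟩
      · rw [eW k hki]; exact hk'.isOpen
      · rw [eW k hki]; exact hk'.cover
      · rw [eW k hki]; exact hk'.lf
      · rw [eH k hki]; exact hk'.lip
      · rw [eH k hki]; exact hk'.zero
      · intro y c θ ha hb hcc
        rw [eU c θ (k + 1) (by omega)]
        refine hk'.good y c θ (fun l hl => ?_) hb hcc
        have := ha l hl
        rwa [eW l (by omega)] at this
    · refine ⟨?_, ?_, ?_, ?_, ?_, ?_⟩
      · rw [eWi]; exact h1
      · rw [eWi]; exact h2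
      · rw [eWi]; exact h3
      · rw [eHi]; exact h4
      · rw [eHi]; exact h5
      · intro y c θ ha hb hcc
        simp only [chainU]
        rw [eU c θ k le_rfl, eHi]
        refine h6 y c θ (fun l hl => ?_) ?_ hb hcc
        · have := ha l (by omega)
          rwa [eW l hl] at this
        · have := ha k (by omega)
          rwa [eWi] at this

/-- The selection theorem. -/
theorem selection {Y E : Type*} [TopologicalSpace Y] [T2Space Y] [ParacompactSpace Y]
    [NormedAddCommGroup E] (m : ℕ) (hdim : CovDimLE Y m) (Φ : Set (Y × E)) (hΦ : IsOpen Φ)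
    (hc : ∀ y, FibreContr m {e | (y, e) ∈ Φ}) :
    ∃ e : C(Y, E), ∀ y, (y, e y) ∈ Φ := by
  classical
  obtain ⟨W, H, hL⟩ := levels_exist m Φ hΦ hc (m + 1) le_rfl
  have hcov : (⋃ c : Fin (m + 1) → Y, ⋂ k : Fin (m + 1), W k (c k)) = Set.univ := by
    refine Set.eq_univ_of_forall fun y => ?_
    choose c hcc using fun k : Fin (m + 1) => (hL k k.2).cover y
    exact mem_iUnion.2 ⟨c, mem_iInter.2 hcc⟩
  obtain ⟨O, s, hO1, hO2, hO3⟩ := ostrand m hdim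
    (fun c : Fin (m + 1) → Y => ⋂ k : Fin (m + 1), W k (c k))
    (fun c => isOpen_iInter_of_finite fun k => (hL k k.2).isOpen _) hcov
  obtain ⟨ρ, hρ⟩ := BumpCovering.exists_isSubordinate isClosed_univ O hO1 hO2.ge
  let cf : Y → ℕ → Y := fun y k => if h : k < m + 1 then s ⟨k, h⟩ y ⟨k, h⟩ else y
  let θf : Y → ℕ → ℝ := fun y k => if h : k < m + 1 then ρ ⟨k, h⟩ y else 0
  have hθc : ∀ k, Continuous fun y => θf y k := by
    intro k
    by_cases h : k < m + 1
    · simp only [θf, h, dif_pos]; exact (ρ ⟨k, h⟩).continuous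
    · simp only [θf, h, dif_neg, not_false_iff]; exact continuous_const
  have hcontAt : ∀ y0, ContinuousAt (fun y => chainU H (cf y) (θf y) (m + 1)) y0 := by
    intro y0
    have h1 : ContinuousAt (fun y => chainU H (cf y0) (θf y) (m + 1)) y0 :=
      chainU_continuousAt H (cf y0) θf (m + 1) y0 (fun k hk => ((hL k hk).lip _).continuous)
        (fun k _ => (hθc k).continuousAt)
    refine h1.congr ?_
    have h2 : ∀ᶠ y in 𝓝 y0, ∀ k : Fin (m + 1), cf y k = cf y0 k ∨ θf y k = 0 := by
      rw [Filter.eventually_all]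
      intro k
      by_cases hk : y0 ∈ O k
      · filter_upwards [(hO3 k y0 hk).2] with y hy
        left
        simp only [cf, k.2, dif_pos, Fin.eta]
        rw [hy]
      · have h3 : y0 ∉ tsupport (ρ k) := fun h => hk (hρ k h)
        filter_upwards [(isClosed_tsupport (ρ k)).isOpen_compl.mem_nhds h3] with y hy
        right
        simp only [θf, k.2, dif_pos, Fin.eta]
        exact image_eq_zero_of_notMem_tsupport hy
    filter_upwards [h2] with y hy
    apply chainU_congr
    intro k hk e
    rcases hy ⟨k, hk⟩ with h | h
    · simp only at h
      rw [h]
    · simp only at h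
      rw [h, (hL k hk).zero, (hL k hk).zero]
  refine ⟨⟨fun y => chainU H (cf y) (θf y) (m + 1), continuous_iff_continuousAt.2 hcontAt⟩, ?_⟩
  intro y
  show (y, chainU H (cf y) (θf y) (m + 1)) ∈ Φ
  have hcv : ∀ k, ∃ s, k < m + 1 → y ∈ W k s := by
    intro k
    by_cases hk : k < m + 1
    · obtain ⟨s, hs⟩ := (hL k hk).cover y
      exact ⟨s, fun _ => hs⟩
    · exact ⟨y, fun h => (hk h).elim⟩
  choose d hd using hcv
  have : chainU H (cf y) (θf y) (m + 1) =
      chainU H (fun k => if θf y k = 0 then d k else cf y k) (θf y) (m + 1) := by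
    apply chainU_congr
    intro k hk e
    by_cases h : θf y k = 0
    · rw [h, (hL k hk).zero, (hL k hk).zero]
    · simp only [h, if_false]
  rw [this]
  apply (hL m (by omega)).good
  · intro k hk
    apply subset_closure
    by_cases h : θf y k = 0
    · simp only [h, if_true]; exact hd k hk
    · simp only [h, if_false]
      have h1 : ρ ⟨k, hk⟩ y ≠ 0 := by simpa only [θf, hk, dif_pos] using h
      have h2 : y ∈ O ⟨k, hk⟩ := hρ _ (subset_tsupport _ h1)
      have h3 := mem_iInter.1 (hO3 _ y h2).1 ⟨k, hk⟩
      simp only [cf, hk, dif_pos]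
      exact h3
  · intro k
    simp only [θf]
    split_ifs with h
    · exact ⟨ρ.nonneg _ _, ρ.le_one _ _⟩
    · exact ⟨le_rfl, zero_le_one⟩
  · obtain ⟨k, hk⟩ := ρ.eventuallyEq_one' y (mem_univ y)
    refine ⟨k, k.2, ?_⟩
    simp only [θf, k.2, dif_pos, Fin.eta]
    exact hk.eq_of_nhds

lemma enum_support {ι : Type} [Fintype ι] [DecidableEq ι] (i0 : ι) (n : ℕ) (S : Finset ι)
    (hS : S.card ≤ n) (c : ι → ℝ) :
    ∃ (s : Fin n → ι) (ν : Fin n → ℝ), ∀ (M : Type) [AddCommGroup M] [Module ℝ M] (b : ι → M),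
      ∑ k, ν k • b (s k) = ∑ i ∈ S, c i • b i := by
  classical
  have : Nonempty (S ↪ Fin n) := by
    apply Function.Embedding.nonempty_of_card_le
    simpa using hS
  obtain ⟨g⟩ := this
  refine ⟨Function.extend g Subtype.val (fun _ => i0), Function.extend g (fun i => c i) 0, ?_⟩
  intro M _ _ b
  rw [← Finset.sum_coe_sort S]
  symm
  apply Fintype.sum_of_injective g g.injective
  · intro k hk
    rw [Function.extend_apply' _ _ _ (by simpa using hk)]
    simp
  · intro i
    rw [g.injective.extend_apply, g.injective.extend_apply]

/-- The parametrization of the bad set. -/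
def badMap {ι : Type} [DecidableEq ι] (n m p : ℕ) (i0 i1 : ι) (s s' : Fin n → ι)
    (q : ((Fin m → ℝ) × (Fin n → ℝ) × (Fin n → ℝ) × ({i : ι // i ≠ i0} → EuclideanSpace ℝ (Fin p)))
      × (ι → EuclideanSpace ℝ (Fin p))) : ι → EuclideanSpace ℝ (Fin p) :=
  let a : ι → EuclideanSpace ℝ (Fin p) := fun i => if h : i ≠ i0 then q.1.2.2.2 ⟨i, h⟩ else 0
  fun i => if h : i ≠ i0 then q.1.2.2.2 ⟨i, h⟩ else
    - q.2 i0 + (∑ k, q.1.2.2.1 k • (q.2 (s' k) + a (s' k)) +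
      (1 + ∑ k, q.1.2.1 k - ∑ k, q.1.2.2.1 k) • (q.2 i1 + a i1))
      - ∑ k, q.1.2.1 k • (q.2 (s k) + a (s k))

lemma badMap_contDiff {ι : Type} [Fintype ι] [DecidableEq ι] (n m p : ℕ) (i0 i1 : ι)
    (s s' : Fin n → ι) : ContDiff ℝ 1 (badMap n m p i0 i1 s s') := by
  have ha : ∀ i : ι, ContDiff ℝ 1 (fun q : ((Fin m → ℝ) × (Fin n → ℝ) × (Fin n → ℝ) ×
      ({i : ι // i ≠ i0} → EuclideanSpace ℝ (Fin p))) × (ι → EuclideanSpace ℝ (Fin p)) =>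
      (if h : i ≠ i0 then q.1.2.2.2 ⟨i, h⟩ else 0 : EuclideanSpace ℝ (Fin p))) := by
    intro i
    by_cases h : i ≠ i0
    · simp only [h, dif_pos, ne_eq, not_false_iff]
      fun_prop
    · simp only [h, dif_neg, not_false_iff]
      fun_prop
  rw [contDiff_pi]
  intro i
  by_cases h : i ≠ i0
  · simp only [badMap, h, dif_pos, ne_eq, not_false_iff]
    fun_prop
  · simp only [badMap, h, dif_neg, not_false_iff]
    have h1 := ha i1
    have h2 := fun k => ha (s k)
    have h3 := fun k => ha (s' k)
    refine ContDiff.sub (ContDiff.add (by fun_prop) (ContDiff.add ?_ ?_)) ?_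
    · refine ContDiff.sum fun k _ => ContDiff.fun_smul ?_ (ContDiff.add ?_ (h3 k)) <;> fun_prop
    · refine ContDiff.fun_smul ?_ (ContDiff.add ?_ h1) <;> fun_prop
    · refine ContDiff.sum fun k _ => ContDiff.fun_smul ?_ (ContDiff.add ?_ (h2 k)) <;> fun_prop

lemma general_position (n m p : ℕ) (hp : p = 2 * n + 1 + m) {ι J : Type} [Fintype ι]
    [DecidableEq ι] [Finite J] (B : J → (Fin m → ℝ) → ι → EuclideanSpace ℝ (Fin p))
    (hB : ∀ c, LocallyLipschitz (B c)) :
    Dense {a : ι → EuclideanSpace ℝ (Fin p) | ∀ c z (μ μ' : ι → ℝ), ∑ i, μ i = 1 → ∑ i, μ' i = 1 →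
      (Finset.univ.filter fun i => μ i ≠ 0).card ≤ n + 1 →
      (Finset.univ.filter fun i => μ' i ≠ 0).card ≤ n + 1 →
      (∀ i, μ i = 0 ∨ μ' i = 0) → ∑ i, (μ i - μ' i) • (B c z i + a i) ≠ 0} := by
  classical
  let Ψ : J × ι × ι × (Fin n → ι) × (Fin n → ι) → Set (ι → EuclideanSpace ℝ (Fin p)) := fun t =>
    Set.range fun q : (Fin m → ℝ) × (Fin n → ℝ) × (Fin n → ℝ) ×
      ({i : ι // i ≠ t.2.1} → EuclideanSpace ℝ (Fin p)) =>
      badMap n m p t.2.1 t.2.2.1 t.2.2.2.1 t.2.2.2.2 (q, B t.1 q.1)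
  have hdimΨ : ∀ t, dimH (Ψ t) ≤ ((m + (n + (n + (Fintype.card ι - 1) * p)) : ℕ) : ENNReal) := by
    rintro ⟨c, i0, i1, s, s'⟩
    simp only [Ψ]
    rw [← Set.image_univ]
    have hlip : LocallyLipschitz fun q : (Fin m → ℝ) × (Fin n → ℝ) × (Fin n → ℝ) ×
      ({i : ι // i ≠ i0} → EuclideanSpace ℝ (Fin p)) =>
      badMap n m p i0 i1 s s' (q, B c q.1) := by
      have h1 : LocallyLipschitz fun q : (Fin m → ℝ) × (Fin n → ℝ) × (Fin n → ℝ) ×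
          ({i : ι // i ≠ i0} → EuclideanSpace ℝ (Fin p)) => B c q.1 :=
        (hB c).comp LipschitzWith.prod_fst.locallyLipschitz
      exact (badMap_contDiff n m p i0 i1 s s').locallyLipschitz.comp
        (LocallyLipschitz.id.prodMk h1)
    refine (dimH_image_le_of_locally_lipschitzOn ?_).trans ?_
    · intro x _
      obtain ⟨C, t, ht, h⟩ := hlip x
      exact ⟨C, t, mem_nhdsWithin_of_mem_nhds ht, h⟩
    · rw [Real.dimH_univ_eq_finrank]
      apply le_of_eq
      congr 1
      simp [Module.finrank_prod, Module.finrank_pi_fintype, Fintype.card_subtype_compl]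
  have hbad : ∀ a : ι → EuclideanSpace ℝ (Fin p), a ∈ (⋃ t, Ψ t)ᶜ →
      a ∈ {a : ι → EuclideanSpace ℝ (Fin p) | ∀ c z (μ μ' : ι → ℝ), ∑ i, μ i = 1 → ∑ i, μ' i = 1 →
      (Finset.univ.filter fun i => μ i ≠ 0).card ≤ n + 1 →
      (Finset.univ.filter fun i => μ' i ≠ 0).card ≤ n + 1 →
      (∀ i, μ i = 0 ∨ μ' i = 0) → ∑ i, (μ i - μ' i) • (B c z i + a i) ≠ 0} := by
    intro a ha c z μ μ' h1 h1' hc hc' hdis hzero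
    apply ha
    obtain ⟨i0, hi0⟩ : ∃ i, μ i ≠ 0 := by
      by_contra hcon
      push Not at hcon
      simp [hcon] at h1
    obtain ⟨i1, hi1⟩ : ∃ i, μ' i ≠ 0 := by
      by_contra hcon
      push Not at hcon
      simp [hcon] at h1'
    have hi01 : μ' i0 = 0 := (hdis i0).resolve_left hi0
    set S := (Finset.univ.filter fun i => μ i ≠ 0).erase i0 with hS
    set S' := (Finset.univ.filter fun i => μ' i ≠ 0).erase i1 with hS'
    have hSc : S.card ≤ n := by
      rw [hS, Finset.card_erase_of_mem (by simpa using hi0)]; omega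
    have hSc' : S'.card ≤ n := by
      rw [hS', Finset.card_erase_of_mem (by simpa using hi1)]; omega
    obtain ⟨s, ν, hν⟩ := enum_support i0 n S hSc (fun i => μ i / μ i0)
    obtain ⟨s', ν', hν'⟩ := enum_support i0 n S' hSc' (fun i => μ' i / μ i0)
    -- decompositions of the sums
    have dec : ∀ (M : Type) [AddCommGroup M] [Module ℝ M] (b : ι → M),
        ∑ i, μ i • b i = μ i0 • (b i0 + ∑ k, ν k • b (s k)) := by
      intro M _ _ b
      rw [hν, smul_add, Finset.smul_sum]
      have e1 : ∀ i ∈ S, μ i0 • (μ i / μ i0) • b i = μ i • b i := by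
        intro i _
        rw [smul_smul, mul_div_cancel₀ _ hi0]
      rw [Finset.sum_congr rfl e1, hS, Finset.add_sum_erase _ (fun i => μ i • b i) (by simpa using hi0)]
      symm
      apply Finset.sum_subset (Finset.subset_univ _)
      intro i _ hi
      have : μ i = 0 := by simpa using hi
      simp [this]
    have dec' : ∀ (M : Type) [AddCommGroup M] [Module ℝ M] (b : ι → M),
        ∑ i, μ' i • b i = μ i0 • ((μ' i1 / μ i0) • b i1 + ∑ k, ν' k • b (s' k)) := by
      intro M _ _ b
      rw [hν', smul_add, Finset.smul_sum]
      have e1 : ∀ i ∈ S', μ i0 • (μ' i / μ i0) • b i = μ' i • b i := by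
        intro i _
        rw [smul_smul, mul_div_cancel₀ _ hi0]
      rw [Finset.sum_congr rfl e1, hS', smul_smul, mul_div_cancel₀ _ hi0,
        Finset.add_sum_erase _ (fun i => μ' i • b i) (by simpa using hi1)]
      symm
      apply Finset.sum_subset (Finset.subset_univ _)
      intro i _ hi
      have : μ' i = 0 := by simpa using hi
      simp [this]
    have hsum : μ' i1 / μ i0 = 1 + ∑ k, ν k - ∑ k, ν' k := by
      have t1 := dec ℝ (fun _ => 1)
      have t2 := dec' ℝ (fun _ => 1)
      simp only [smul_eq_mul, mul_one] at t1 t2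
      rw [h1] at t1
      rw [h1'] at t2
      have t3 := mul_left_cancel₀ hi0 (t1.symm.trans t2)
      linarith
    let a0 : ι → EuclideanSpace ℝ (Fin p) := fun i => if h : i ≠ i0 then a i else 0
    have key : a i0 = - B c z i0 + (∑ k, ν' k • (B c z (s' k) + a0 (s' k)) +
        (1 + ∑ k, ν k - ∑ k, ν' k) • (B c z i1 + a0 i1)) - ∑ k, ν k • (B c z (s k) + a0 (s k)) := by
      have hne : i1 ≠ i0 := fun h => hi1 (h ▸ hi01)
      have u1 : ∑ k, ν k • (B c z (s k) + a0 (s k)) = ∑ k, ν k • (B c z (s k) + a (s k)) := by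
        rw [hν _ (fun i => B c z i + a0 i), hν _ (fun i => B c z i + a i)]
        refine Finset.sum_congr rfl fun i hi => ?_
        have : i ≠ i0 := (Finset.mem_erase.1 hi).1
        simp [a0, this]
      have u2 : ∑ k, ν' k • (B c z (s' k) + a0 (s' k)) = ∑ k, ν' k • (B c z (s' k) + a (s' k)) := by
        rw [hν' _ (fun i => B c z i + a0 i), hν' _ (fun i => B c z i + a i)]
        refine Finset.sum_congr rfl fun i hi => ?_
        have : i ≠ i0 := by
          rintro rfl
          have := (Finset.mem_erase.1 hi).2
          simp [hi01] at this
        simp [a0, this]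
      have u3 : a0 i1 = a i1 := by simp [a0, hne]
      rw [u1, u2, u3, ← hsum]
      simp only [sub_smul, Finset.sum_sub_distrib] at hzero
      rw [dec _ (fun i => B c z i + a i), dec' _ (fun i => B c z i + a i), ← smul_sub] at hzero
      have := (smul_eq_zero.1 hzero).resolve_left hi0
      have h4 := sub_eq_zero.1 this
      have h5 : a i0 = - B c z i0 + ((B c z i0 + a i0) +
        ∑ k, ν k • (B c z (s k) + a (s k))) - ∑ k, ν k • (B c z (s k) + a (s k)) := by abel
      rw [h4] at h5
      rw [h5]
      abel
    refine mem_iUnion.2 ⟨(c, i0, i1, s, s'), ⟨(z, ν, ν', fun i => a i), ?_⟩⟩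
    funext i
    by_cases h : i ≠ i0
    · simp [badMap, h]
    · rw [not_not] at h
      subst h
      simp only [badMap, ne_eq, not_true_eq_false, dif_neg, not_false_iff]
      exact key.symm
  rcases isEmpty_or_nonempty ι with hι | hι
  · convert dense_univ
    apply Set.eq_univ_of_forall
    intro a c z μ μ' h1
    simp at h1
  refine Dense.mono hbad (dense_compl_of_dimH_lt_finrank ?_)
  rw [dimH_iUnion]
  refine lt_of_le_of_lt (iSup_le hdimΨ) ?_
  have hcard : 0 < Fintype.card ι := Fintype.card_pos
  rw [Module.finrank_pi_fintype]
  simp only [finrank_euclideanSpace, Fintype.card_fin, Finset.sum_const, Finset.card_univ,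
    smul_eq_mul]
  norm_cast
  obtain ⟨r, hr⟩ : ∃ r, Fintype.card ι = r + 1 := ⟨Fintype.card ι - 1, by omega⟩
  rw [hr, Nat.add_sub_cancel, add_mul, one_mul]
  omega

lemma unif_delta {S ι : Type*} [TopologicalSpace S] [Finite ι] (K : Set S) (hK : IsCompact K)
    (f : ι → S → ℝ) (hf : ∀ i, Continuous (f i)) (hpos : ∀ i, ∀ s ∈ K, 0 < f i s) :
    ∃ δ > 0, ∀ i, ∀ s ∈ K, 5 * δ < f i s := by
  have h1 : ∀ i, ∃ δ > 0, ∀ s ∈ K, 5 * δ < f i s := by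
    intro i
    rcases K.eq_empty_or_nonempty with rfl | hne
    · exact ⟨1, one_pos, fun s hs => hs.elim⟩
    · obtain ⟨s0, hs0, hmin⟩ := hK.exists_isMinOn hne (hf i).continuousOn
      refine ⟨f i s0 / 6, div_pos (hpos i s0 hs0) (by norm_num), fun s hs => ?_⟩
      have := hmin hs
      have h0 := hpos i s0 hs0
      simp only [mem_ofPred_eq] at this
      linarith
  choose d hd hds using h1
  rcases isEmpty_or_nonempty ι with h | h
  · exact ⟨1, one_pos, fun i => h.elim i⟩
  · obtain ⟨i0, hi0⟩ := Finite.exists_min d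
    refine ⟨d i0, hd i0, fun i s hs => lt_of_le_of_lt ?_ (hds i s hs)⟩
    linarith [hi0 i]

lemma fibre_cover {X : Type*} [TopologicalSpace X] [T2Space X] [ParacompactSpace X] (n : ℕ)
    (K : Set X) (hK : IsCompact K) (hKdim : CovDimLE K n) (U : X → Set X)
    (hU : ∀ x ∈ K, U x ∈ 𝓝 x) :
    ∃ (r : ℕ) (xs : Fin r → X) (μ : Fin r → C(X, ℝ)), (∀ i, xs i ∈ K) ∧
      (∀ i x, μ i x ∈ Icc (0 : ℝ) 1) ∧ (∀ x ∈ K, ∑ i, μ i x = 1) ∧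
      (∀ x ∈ K, ∀ i, μ i x ≠ 0 → x ∈ U (xs i)) ∧
      ∀ x ∈ K, (Finset.univ.filter fun i => μ i x ≠ 0).card ≤ n + 1 := by
  classical
  have : CompactSpace K := isCompact_iff_compactSpace.1 hK
  obtain ⟨t, htK, hcov⟩ := hK.elim_nhds_subcover (fun x => interior (U x))
    (fun x hx => interior_mem_nhds.2 (hU x hx))
  let e := t.equivFin
  let xs : Fin t.card → X := fun i => (e.symm i : X)
  have hxs : ∀ i, xs i ∈ K := fun i => htK _ (e.symm i).2
  obtain ⟨V, hVo, hVU, hVc, hVn⟩ := hKdim (Fin t.card)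
    (fun i => (Subtype.val ⁻¹' interior (U (xs i)) : Set K)) inferInstance
    (fun i => isOpen_interior.preimage continuous_subtype_val) (by
      refine Set.eq_univ_of_forall fun x => ?_
      obtain ⟨s, hs, hxs⟩ := mem_iUnion₂.1 (hcov x.2)
      refine mem_iUnion.2 ⟨e ⟨s, hs⟩, ?_⟩
      simpa [xs] using hxs)
  obtain ⟨ρ, hρ⟩ := PartitionOfUnity.exists_isSubordinate isClosed_univ V hVo hVc.ge
  have hext : ∀ i, ∃ μ : C(X, ℝ), (∀ x, μ x ∈ Icc (0 : ℝ) 1) ∧ μ.restrict K = ρ i := by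
    intro i
    obtain ⟨μ, h1, h2⟩ := ContinuousMap.exists_restrict_eq_forall_mem_of_closed (ρ i)
      (t := Icc (0 : ℝ) 1) (fun x => ⟨ρ.nonneg i x, ρ.le_one i x⟩) ⟨0, by simp⟩ hK.isClosed
    exact ⟨μ, h1, h2⟩
  choose μ hμ01 hμ using hext
  have hval : ∀ i (x : X) (hx : x ∈ K), μ i x = ρ i ⟨x, hx⟩ := by
    intro i x hx
    rw [← hμ i]; rfl
  have hV : ∀ i (x : X) (hx : x ∈ K), μ i x ≠ 0 → (⟨x, hx⟩ : K) ∈ V i := by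
    intro i x hx h
    rw [hval i x hx] at h
    exact hρ i (subset_closure h)
  refine ⟨t.card, xs, μ, hxs, hμ01, ?_, ?_, ?_⟩
  · intro x hx
    have := ρ.sum_eq_one (mem_univ (⟨x, hx⟩ : K))
    rw [finsum_eq_sum_of_fintype] at this
    rw [← this]
    exact Finset.sum_congr rfl fun i _ => hval i x hx
  · intro x hx i hi
    exact interior_subset (hVU i (hV i x hx hi))
  · intro x hx
    have h1 := hVn ⟨x, hx⟩
    have h2 : (Finset.univ.filter fun i => μ i x ≠ 0).card ≤ ({i | (⟨x, hx⟩ : K) ∈ V i}).ncard := by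
      rw [← Set.ncard_coe_finset]
      apply Set.ncard_le_ncard _ (Set.toFinite _)
      intro i hi
      exact hV i x hx (by simpa using hi)
    have : ((Finset.univ.filter fun i => μ i x ≠ 0).card : ℤ) ≤ n + 1 := le_trans (by exact_mod_cast h2) h1
    exact_mod_cast this

def bcfSingle {X : Type*} [TopologicalSpace X] {E : Type*} [NormedAddCommGroup E] [NormedSpace ℝ E]
    (μ : C(X, ℝ)) (hμ : ∀ x, μ x ∈ Icc (0 : ℝ) 1) : E →L[ℝ] BoundedContinuousFunction X E :=
  LinearMap.mkContinuous
    { toFun := fun v => BoundedContinuousFunction.ofNormedAddCommGroup (fun x => μ x • v)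
        (by fun_prop) ‖v‖ (fun x => by
          rw [norm_smul, Real.norm_of_nonneg (hμ x).1]
          exact mul_le_of_le_one_left (norm_nonneg _) (hμ x).2)
      map_add' := fun v w => by ext x; simp
      map_smul' := fun c v => by ext x; simp [smul_comm (μ x) c v] } 1 (fun v => by
        rw [one_mul]
        refine BoundedContinuousFunction.norm_ofNormedAddCommGroup_le _ (norm_nonneg _) (fun x => ?_)
        rw [norm_smul, Real.norm_of_nonneg (hμ x).1]
        exact mul_le_of_le_one_left (norm_nonneg _) (hμ x).2)

lemma bcfSingle_apply {X : Type*} [TopologicalSpace X] {E : Type*} [NormedAddCommGroup E]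
    [NormedSpace ℝ E] (μ : C(X, ℝ)) (hμ : ∀ x, μ x ∈ Icc (0 : ℝ) 1) (v : E) (x : X) :
    bcfSingle μ hμ v x = μ x • v := rfl

lemma homot_exists {X : Type*} [TopologicalSpace X] {E : Type*} [NormedAddCommGroup E]
    [NormedSpace ℝ E] {ι : Type*} [Fintype ι] (xs : ι → X) (μ : ι → C(X, ℝ))
    (hμ : ∀ i x, μ i x ∈ Icc (0 : ℝ) 1) (a : ι → E) :
    ∃ H : BoundedContinuousFunction X E × ℝ → BoundedContinuousFunction X E, LocallyLipschitz H ∧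
      ∀ u t x, H (u, t) x = max 0 (1 - 2 * t) • u x + ∑ i, μ i x •
        ((1 - max 0 (1 - 2 * t) - max 0 (2 * t - 1)) • u (xs i) + max 0 (2 * t - 1) • a i) := by
  let ev : ι → BoundedContinuousFunction X E →L[ℝ] E := fun i =>
    BoundedContinuousFunction.evalCLM ℝ (xs i)
  let G : BoundedContinuousFunction X E × ℝ × ℝ → BoundedContinuousFunction X E := fun q =>
    q.2.1 • q.1 + ∑ i, bcfSingle (μ i) (hμ i) ((1 - q.2.1 - q.2.2) • ev i q.1 + q.2.2 • a i)
  have hG : ContDiff ℝ 1 G := by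
    simp only [G]
    fun_prop
  have hl : LocallyLipschitz fun q : BoundedContinuousFunction X E × ℝ =>
      (q.1, max 0 (1 - 2 * q.2), max 0 (2 * q.2 - 1)) := by
    refine LocallyLipschitz.prodMk LipschitzWith.prod_fst.locallyLipschitz
      (LocallyLipschitz.prodMk ?_ ?_)
    · have h1 : ContDiff ℝ 1 (fun t : ℝ => 1 - 2 * t) := by fun_prop
      exact LocallyLipschitz.comp (f := fun t : ℝ => max 0 (1 - 2 * t))
        ((LipschitzWith.const 0).locallyLipschitz.max h1.locallyLipschitz)
        LipschitzWith.prod_snd.locallyLipschitz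
    · have h1 : ContDiff ℝ 1 (fun t : ℝ => 2 * t - 1) := by fun_prop
      exact LocallyLipschitz.comp (f := fun t : ℝ => max 0 (2 * t - 1))
        ((LipschitzWith.const 0).locallyLipschitz.max h1.locallyLipschitz)
        LipschitzWith.prod_snd.locallyLipschitz
  refine ⟨fun q => G (q.1, max 0 (1 - 2 * q.2), max 0 (2 * q.2 - 1)), hG.locallyLipschitz.comp hl, ?_⟩
  intro u t x
  simp only [G, BoundedContinuousFunction.add_apply, BoundedContinuousFunction.smul_apply,
    BoundedContinuousFunction.sum_apply, bcfSingle_apply]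
  rfl

lemma cvx_est {E : Type*} [NormedAddCommGroup E] [NormedSpace ℝ E] {ι : Type*} [Fintype ι]
    (c0 c1 c2 M : ℝ) (h0 : 0 ≤ c0) (h1 : 0 ≤ c1) (h2 : 0 ≤ c2) (hs : c0 + c1 + c2 = 1)
    (μ : ι → ℝ) (hμ : ∀ i, 0 ≤ μ i) (hμs : ∑ i, μ i = 1) (w U : E) (p a : ι → E)
    (hU : ‖U - w‖ ≤ M) (hp : ∀ i, μ i ≠ 0 → ‖p i - w‖ ≤ M)
    (ha : c2 ≠ 0 → ∀ i, μ i ≠ 0 → ‖a i - w‖ ≤ M) :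
    ‖c0 • U + ∑ i, μ i • (c1 • p i + c2 • a i) - w‖ ≤ M := by
  have e : c0 • U + ∑ i, μ i • (c1 • p i + c2 • a i) - w =
      c0 • (U - w) + ∑ i, μ i • (c1 • (p i - w) + c2 • (a i - w)) := by
    have : ∀ i, μ i • (c1 • (p i - w) + c2 • (a i - w)) =
        μ i • (c1 • p i + c2 • a i) - μ i • ((c1 + c2) • w) := by
      intro i; module
    simp only [this, Finset.sum_sub_distrib]
    rw [← Finset.sum_smul, hμs]
    have h3 : w = (c0 + c1 + c2) • w := by rw [hs, one_smul]
    nth_rewrite 1 [h3]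
    module
  rw [e]
  have b : ∀ i, ‖μ i • (c1 • (p i - w) + c2 • (a i - w))‖ ≤ μ i * ((c1 + c2) * M) := by
    intro i
    rw [norm_smul, Real.norm_of_nonneg (hμ i)]
    by_cases hi : μ i = 0
    · simp [hi]
    · refine mul_le_mul_of_nonneg_left ?_ (hμ i)
      refine (norm_add_le _ _).trans ?_
      rw [norm_smul, norm_smul, Real.norm_of_nonneg h1, Real.norm_of_nonneg h2, add_mul]
      refine add_le_add (mul_le_mul_of_nonneg_left (hp i hi) h1) ?_
      by_cases hc : c2 = 0
      · simp [hc]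
      · exact mul_le_mul_of_nonneg_left (ha hc i hi) h2
  calc ‖c0 • (U - w) + ∑ i, μ i • (c1 • (p i - w) + c2 • (a i - w))‖
      ≤ ‖c0 • (U - w)‖ + ∑ i, ‖μ i • (c1 • (p i - w) + c2 • (a i - w))‖ :=
        (norm_add_le _ _).trans (add_le_add le_rfl (norm_sum_le _ _))
    _ ≤ c0 * M + ∑ i, μ i * ((c1 + c2) * M) := by
        refine add_le_add ?_ (Finset.sum_le_sum fun i _ => b i)
        rw [norm_smul, Real.norm_of_nonneg h0]
        exact mul_le_mul_of_nonneg_left hU h0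
    _ = (c0 + c1 + c2) * M := by rw [← Finset.sum_mul, hμs]; ring
    _ = M := by rw [hs, one_mul]

lemma smul_eval_lip {X E : Type*} [TopologicalSpace X] [NormedAddCommGroup E] [NormedSpace ℝ E]
    {m r : ℕ} (xs : Fin r → X) (j : Fin m) (φ : (Fin m → ℝ) → BoundedContinuousFunction X E)
    (hφ : LocallyLipschitz φ) :
    LocallyLipschitz (fun (z : Fin m → ℝ) (i : Fin r) => z j • φ z (xs i)) := by
  let ev : Fin r → BoundedContinuousFunction X E →L[ℝ] E :=
    fun i => BoundedContinuousFunction.evalCLM ℝ (xs i)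
  have h1 : ContDiff ℝ 1 (fun (q : ℝ × BoundedContinuousFunction X E)
    (i : Fin r) => q.1 • ev i q.2) := by fun_prop
  have h2 : ContDiff ℝ 1 (fun z : Fin m → ℝ => z j) := by fun_prop
  exact h1.locallyLipschitz.comp (h2.locallyLipschitz.prodMk hφ)

set_option maxHeartbeats 2000000 in
lemma fibre_contr {X Z : Type*} [TopologicalSpace X] [T2Space X] [ParacompactSpace X]
    [PseudoMetricSpace Z] (n m p : ℕ) (hp : p = 2 * n + 1 + m) (K : Set X) (hK : IsCompact K)
    (hKdim : CovDimLE K n) (h : C(X, Z)) (ε : ℝ) (hε : 0 < ε)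
    (g : C(X, EuclideanSpace ℝ (Fin p))) (β : C(X, ℝ)) (hβ : ∀ x, 0 < β x) :
    FibreContr m {e : BoundedContinuousFunction X (EuclideanSpace ℝ (Fin p)) |
      (∀ x ∈ K, dist (e x) (g x) < β x) ∧
      ∀ x ∈ K, ∀ x' ∈ K, ε ≤ dist (h x) (h x') → e x ≠ e x'} := by
  classical
  intro N j φ hφ hφu hφΦ
  have hφc : ∀ c, Continuous (φ c) := fun c => (hφ c).continuous
  set C : Set (Fin m → ℝ) := {z | ∀ i, z i ∈ Icc (0 : ℝ) 1} with hC
  have hCc : IsCompact C := by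
    have : C = Set.pi univ (fun _ => Icc (0 : ℝ) 1) := by
      ext z; simp only [hC, mem_ofPred_eq, mem_pi, mem_univ, true_imp_iff]
    rw [this]
    exact isCompact_univ_pi fun _ => isCompact_Icc
  have hD : IsCompact {q : X × X | (q.1 ∈ K ∧ q.2 ∈ K) ∧ ε ≤ dist (h q.1) (h q.2)} := by
    have h1 : IsClosed {q : X × X | ε ≤ dist (h q.1) (h q.2)} :=
      isClosed_le (by fun_prop) (by fun_prop)
    exact (hK.prod hK).inter_right h1
  obtain ⟨δ1, hδ1, H1⟩ := unif_delta (C ×ˢ {q : X × X | (q.1 ∈ K ∧ q.2 ∈ K) ∧ ε ≤ dist (h q.1) (h q.2)})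
    (hCc.prod hD) (fun (c : Fin N) q => ‖φ c q.1 q.2.1 - φ c q.1 q.2.2‖)
    (fun c => by have := hφc c; fun_prop) (by
      rintro c ⟨z, x, x'⟩ ⟨hz, ⟨hx, hx'⟩, hd⟩
      exact norm_pos_iff.2 (sub_ne_zero.2 ((hφΦ c z hz).2 x hx x' hx' hd)))
  obtain ⟨δ2, hδ2, H2⟩ := unif_delta (C ×ˢ K)
    (hCc.prod hK) (fun (c : Fin N) q => β q.2 - dist (φ c q.1 q.2) (g q.2))
    (fun c => by have := hφc c; fun_prop) (by
      rintro c ⟨z, x⟩ ⟨hz, hx⟩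
      exact sub_pos.2 ((hφΦ c z hz).1 x hx))
  obtain ⟨δ3, hδ3, H3⟩ := unif_delta K hK (fun (_ : Unit) q => β q)
    (fun c => by fun_prop) (fun _ x _ => hβ x)
  set δ := min δ1 (min δ2 δ3) with hδdef
  have hδ : 0 < δ := lt_min hδ1 (lt_min hδ2 hδ3)
  have hle1 : δ ≤ δ1 := min_le_left _ _
  have hle2 : δ ≤ δ2 := (min_le_right _ _).trans (min_le_left _ _)
  have hle3 : δ ≤ δ3 := (min_le_right _ _).trans (min_le_right _ _)
  have H1' : ∀ c, ∀ z ∈ C, ∀ x ∈ K, ∀ x' ∈ K, ε ≤ dist (h x) (h x') →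
      5 * δ < ‖φ c z x - φ c z x'‖ := fun c z hz x hx x' hx' hd =>
    lt_of_le_of_lt (by linarith) (H1 c (z, x, x') ⟨hz, ⟨hx, hx'⟩, hd⟩)
  have H2' : ∀ c, ∀ z ∈ C, ∀ x ∈ K, dist (φ c z x) (g x) + 5 * δ < β x := by
    intro c z hz x hx
    have := H2 c (z, x) ⟨hz, hx⟩
    simp only at this
    linarith
  have H3' : ∀ x ∈ K, 5 * δ < β x := fun x hx => lt_of_le_of_lt (by linarith) (H3 () x hx)
  -- neighbourhoods
  let U : X → Set X := fun x => {x' | (∀ c, ∀ z ∈ C, dist (φ c z x') (φ c z x) < δ) ∧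
    dist (h x') (h x) < ε / 2 ∧ dist (g x') (g x) < δ}
  have hU : ∀ x ∈ K, U x ∈ 𝓝 x := by
    intro x _
    have u1 : ∀ᶠ x' in 𝓝 x, ∀ c, ∀ z ∈ C, dist (φ c z x') (φ c z x) < δ := by
      rw [Filter.eventually_all]
      intro c
      refine hCc.eventually_forall_of_forall_eventually fun z _ => ?_
      have hcont : Continuous fun q : X × (Fin m → ℝ) => dist (φ c q.2 q.1) (φ c q.2 x) := by
        have := hφc c; fun_prop
      refine hcont.continuousAt.eventually_lt continuousAt_const ?_
      simpa using hδ
    have u2 : ∀ᶠ x' in 𝓝 x, dist (h x') (h x) < ε / 2 := by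
      have hcont : Continuous fun x' => dist (h x') (h x) := by fun_prop
      refine hcont.continuousAt.eventually_lt continuousAt_const ?_
      simpa using hε
    have u3 : ∀ᶠ x' in 𝓝 x, dist (g x') (g x) < δ := by
      have hcont : Continuous fun x' => dist (g x') (g x) := by fun_prop
      refine hcont.continuousAt.eventually_lt continuousAt_const ?_
      simpa using hδ
    filter_upwards [u1, u2, u3] with x' a b c using ⟨a, b, c⟩
  obtain ⟨r, xs, μ, hxs, hμ01, hμs, hμU, hμn⟩ := fibre_cover n K hK hKdim U hU
  have hdisj : ∀ x ∈ K, ∀ x' ∈ K, ε ≤ dist (h x) (h x') → ∀ i, μ i x = 0 ∨ μ i x' = 0 := by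
    intro x hx x' hx' hd i
    by_contra hcon
    push Not at hcon
    have a1 := (hμU x hx i hcon.1).2.1
    have a2 := (hμU x' hx' i hcon.2).2.1
    have := dist_triangle_right (h x) (h x') (h (xs i))
    linarith
  -- general position
  let B : Option (Fin N) → (Fin m → ℝ) → Fin r → EuclideanSpace ℝ (Fin p) := fun o z i =>
    match o with
    | none => 0
    | some c => z (j c) • φ c z (xs i)
  have hB : ∀ o, LocallyLipschitz (B o) := by
    intro o
    match o with
    | none => exact (LipschitzWith.const (0 : Fin r → EuclideanSpace ℝ (Fin p))).locallyLipschitz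
    | some c =>
      exact smul_eval_lip xs (j c) (φ c) (hφ c)
  obtain ⟨a, haGP, hag⟩ := (general_position n m p hp B hB).exists_dist_lt
    (fun i => g (xs i)) hδ
  have hag' : ∀ i, dist (a i) (g (xs i)) < δ := fun i => by
    rw [dist_comm]; exact lt_of_le_of_lt (dist_le_pi_dist (fun i => g (xs i)) a i) hag
  have hane : ∀ x ∈ K, ∀ i, μ i x ≠ 0 → ‖a i - g x‖ ≤ 2 * δ := by
    intro x hx i hi
    have a1 := (hμU x hx i hi).2.2
    have a2 := dist_triangle_right (a i) (g x) (g (xs i))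
    rw [← dist_eq_norm]
    linarith [hag' i]
  obtain ⟨H, hHl, hH⟩ := homot_exists xs μ hμ01 a
  refine ⟨H, hHl, ?_, ?_, ?_⟩
  · intro e
    ext1 x
    rw [hH]
    norm_num
  · let e1 : BoundedContinuousFunction X (EuclideanSpace ℝ (Fin p)) := H (0, 1)
    have he1 : ∀ x, e1 x = ∑ i, μ i x • a i := by
      intro x
      simp only [e1]
      rw [hH]
      norm_num
    refine ⟨e1, ⟨?_, ?_⟩, ?_⟩
    · intro x hx
      have := cvx_est 0 0 1 (2 * δ) le_rfl le_rfl zero_le_one (by norm_num) (fun i => μ i x)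
        (fun i => (hμ01 i x).1) (hμs x hx) (g x) (g x) (fun _ => g x) a
        (by simpa using hδ.le) (fun _ _ => by simpa using hδ.le) (fun _ => hane x hx)
      simp only [zero_smul, zero_add, one_smul] at this
      rw [he1, dist_eq_norm]
      linarith [H3' x hx]
    · intro x hx x' hx' hd heq
      refine haGP none 0 (fun i => μ i x) (fun i => μ i x') (hμs x hx) (hμs x' hx') (hμn x hx)
        (hμn x' hx') (hdisj x hx x' hx' hd) ?_
      rw [he1, he1] at heq
      simp only [B, zero_add, sub_smul, Finset.sum_sub_distrib]
      exact sub_eq_zero.2 heq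
    · intro e
      ext1 x
      rw [hH, he1]
      norm_num
  · intro c z hz t ht
    have hun : ∀ x ∈ K, ∀ i, μ i x ≠ 0 → ‖φ c z (xs i) - φ c z x‖ ≤ δ := by
      intro x hx i hi
      rw [← dist_eq_norm, dist_comm]
      exact ((hμU x hx i hi).1 c z hz).le
    have k0 : 0 ≤ max 0 (1 - 2 * t) := le_max_left _ _
    have k2 : 0 ≤ max 0 (2 * t - 1) := le_max_left _ _
    have k1 : 0 ≤ 1 - max 0 (1 - 2 * t) - max 0 (2 * t - 1) := by
      rcases le_total t (1 / 2) with h | h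
      · rw [max_eq_right (by linarith), max_eq_left (by linarith)]; linarith [ht.1]
      · rw [max_eq_left (by linarith), max_eq_right (by linarith)]; linarith [ht.2]
    refine ⟨?_, ?_⟩
    · intro x hx
      have hM := H2' c z hz x hx
      have := cvx_est _ _ _ (max (dist (φ c z x) (g x) + δ) (2 * δ)) k0 k1 k2 (by ring)
        (fun i => μ i x) (fun i => (hμ01 i x).1) (hμs x hx) (g x) (φ c z x)
        (fun i => φ c z (xs i)) a (by
          rw [← dist_eq_norm]; exact le_max_of_le_left (by linarith)) (by
          intro i hi
          refine le_max_of_le_left ?_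
          have := dist_triangle (φ c z (xs i)) (φ c z x) (g x)
          have h3 := hun x hx i hi
          rw [← dist_eq_norm] at h3 ⊢
          linarith) (fun _ i hi => le_max_of_le_right (hane x hx i hi))
      rw [hH, dist_eq_norm]
      refine lt_of_le_of_lt this (max_lt ?_ ?_)
      · linarith
      · linarith [H3' x hx]
    · intro x hx x' hx' hd heq
      rcases le_or_gt t (1 / 2) with h12 | h12
      · have z2 : max 0 (2 * t - 1) = 0 := max_eq_left (by linarith)
        have est : ∀ y ∈ K, ‖H (φ c z, t) y - φ c z y‖ ≤ δ := by
          intro y hy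
          rw [hH]
          refine cvx_est _ _ _ δ k0 k1 k2 (by ring)
            (fun i => μ i y) (fun i => (hμ01 i y).1) (hμs y hy) (φ c z y) (φ c z y)
            (fun i => φ c z (xs i)) a (by simpa using hδ.le) (hun y hy) (fun h => (h z2).elim)
        have b1 := H1' c z hz x hx x' hx' hd
        have b2 := est x hx
        have b3 := est x' hx'
        rw [← heq] at b3
        rw [← dist_eq_norm] at b1 b2 b3
        have := dist_triangle_left (φ c z x) (φ c z x') (H (φ c z, t) x)
        linarith
      · have z0 : max 0 (1 - 2 * t) = 0 := max_eq_left (by linarith)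
        have z2 : max 0 (2 * t - 1) = 2 * t - 1 := max_eq_right (by linarith)
        have c2pos : 0 < 2 * t - 1 := by linarith
        set κ := (1 - (2 * t - 1)) / (2 * t - 1) with hκ
        refine haGP (some c) (Function.update z (j c) κ) (fun i => μ i x) (fun i => μ i x')
          (hμs x hx) (hμs x' hx') (hμn x hx) (hμn x' hx') (hdisj x hx x' hx' hd) ?_
        rw [hH, hH, z0, z2] at heq
        simp only [zero_smul, zero_add, sub_zero] at heq
        simp only [B, hφu, Function.update_self]
        have q : ∀ i, (μ i x - μ i x') • (κ • φ c z (xs i) + a i) = (2 * t - 1)⁻¹ •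
            (μ i x • ((1 - (2 * t - 1)) • φ c z (xs i) + (2 * t - 1) • a i) -
             μ i x' • ((1 - (2 * t - 1)) • φ c z (xs i) + (2 * t - 1) • a i)) := by
          intro i
          have q1 : (2 * t - 1)⁻¹ • ((1 - (2 * t - 1)) • φ c z (xs i) + (2 * t - 1) • a i) =
              κ • φ c z (xs i) + a i := by
            rw [smul_add, smul_smul, smul_smul, inv_mul_cancel₀ c2pos.ne', one_smul, hκ,
              div_eq_inv_mul]
          rw [← sub_smul, smul_comm (2 * t - 1)⁻¹, q1]
        rw [Finset.sum_congr rfl fun i _ => q i, ← Finset.smul_sum, Finset.sum_sub_distrib, heq,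
          sub_self, smul_zero]

lemma proper_forall_open {A B E : Type*} [TopologicalSpace A] [TopologicalSpace B]
    [TopologicalSpace E] (q : A → B) (hq : IsProperMap q) (P : Set (A × E)) (hP : IsOpen P) :
    IsOpen {s : B × E | ∀ a, q a = s.1 → (a, s.2) ∈ P} := by
  have h1 : IsProperMap (Prod.map q (id : E → E)) := hq.prodMap isProperMap_id
  have h2 := h1.isClosedMap _ hP.isClosed_compl
  rw [← isClosed_compl_iff]
  convert h2 using 1
  ext ⟨b, e⟩
  simp only [mem_compl_iff, mem_ofPred_eq, mem_image, Prod.exists, Prod.map_apply, id,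
    Prod.mk.injEq, not_forall]
  constructor
  · rintro ⟨a, ha, hn⟩
    exact ⟨a, e, hn, ha, rfl⟩
  · rintro ⟨a, e', hn, ha, rfl⟩
    exact ⟨a, ha, hn⟩

lemma IsPerfectMap.proper {X Y : Type*} [TopologicalSpace X] [TopologicalSpace Y] {f : X → Y}
    (hf : IsPerfectMap f) : IsProperMap f :=
  isProperMap_iff_isClosedMap_and_compact_fibers.2 hf

lemma cube_approx {p : ℕ} (g c v : EuclideanSpace ℝ (Fin p)) (b : ℝ) (hb : 0 < b) (hb1 : b ≤ 1)
    (hg : g ∈ cube p) (hc : ∀ i, c i = 1 / 2) (hv : dist v (g + b • (c - g)) < b / 2) :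
    v ∈ cube p := by
  intro i
  have h1 : ‖(v - (g + b • (c - g))) i‖ ≤ ‖v - (g + b • (c - g))‖ := PiLp.norm_apply_le _ i
  rw [dist_eq_norm] at hv
  have h2 := lt_of_le_of_lt h1 hv
  rw [Real.norm_eq_abs, abs_lt] at h2
  simp only [PiLp.sub_apply, PiLp.add_apply, PiLp.smul_apply, smul_eq_mul, hc] at h2
  obtain ⟨g0, g1⟩ := hg i
  constructor
  · nlinarith
  · nlinarith

lemma dens {X Y Z : Type*} [TopologicalSpace X] [TopologicalSpace Y]
    [T2Space X] [T2Space Y] [ParacompactSpace X] [ParacompactSpace Y] [PseudoMetricSpace Z]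
    (n m p : ℕ) (hp : p = 2 * n + 1 + m) (f : X → Y) (hperf : IsPerfectMap f)
    (hdimf : ∀ y : Y, CovDimLE ↥(f ⁻¹' {y}) n) (hdimY : CovDimLE Y m)
    (h : C(X, Z)) (ε : ℝ) (hε : 0 < ε) (g : C(X, cube p)) (α : C(X, ℝ)) (hα : ∀ x, 0 < α x) :
    ∃ g' : C(X, cube p), (∀ x, dist (g x) (g' x) ≤ α x) ∧
      ∀ x x', f x = f x' → ε ≤ dist (h x) (h x') → g' x ≠ g' x' := by
  let c : EuclideanSpace ℝ (Fin p) := WithLp.toLp 2 (fun _ => 1 / 2)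
  have hc : ∀ i, c i = 1 / 2 := fun i => rfl
  have hden : ∀ x, 0 < ‖c - (g x : EuclideanSpace ℝ (Fin p))‖ + 1 := fun x => by positivity
  let b : C(X, ℝ) := ⟨fun x => min 1 (α x / (‖c - (g x : EuclideanSpace ℝ (Fin p))‖ + 1)), by
    refine continuous_const.min (Continuous.div (by fun_prop) (by fun_prop) fun x => (hden x).ne')⟩
  have hb0 : ∀ x, 0 < b x := fun x => lt_min one_pos (div_pos (hα x) (hden x))
  have hb1 : ∀ x, b x ≤ 1 := fun x => min_le_left _ _
  have hbα : ∀ x, b x * (‖c - (g x : EuclideanSpace ℝ (Fin p))‖ + 1) ≤ α x := fun x => by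
    rw [← le_div_iff₀ (hden x)]; exact min_le_right _ _
  let gt : C(X, EuclideanSpace ℝ (Fin p)) :=
    ⟨fun x => (g x : EuclideanSpace ℝ (Fin p)) + b x • (c - g x), by fun_prop⟩
  have hgt : ∀ x, gt x = (g x : EuclideanSpace ℝ (Fin p)) + b x • (c - g x) := fun x => rfl
  let β : C(X, ℝ) := ⟨fun x => b x / 2, by fun_prop⟩
  have hβ : ∀ x, 0 < β x := fun x => half_pos (hb0 x)
  let E := BoundedContinuousFunction X (EuclideanSpace ℝ (Fin p))
  let P1 : Set (X × E) := {s | dist (s.2 s.1) (gt s.1) < β s.1}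
  have hP1 : IsOpen P1 := isOpen_lt (by fun_prop) (by fun_prop)
  let P2 : Set ((X × X) × E) := {s | dist (h s.1.1) (h s.1.2) < ε} ∪ {s | s.2 s.1.1 ≠ s.2 s.1.2}
  have hP2 : IsOpen P2 := (isOpen_lt (by fun_prop) (by fun_prop)).union
    (isOpen_ne_fun (by fun_prop) (by fun_prop))
  have hpr := hperf.proper
  have hO1 := proper_forall_open f hpr P1 hP1
  have hO2 := (proper_forall_open (Prod.map f f) (hpr.prodMap hpr) P2 hP2).preimage
    (f := fun s : Y × E => ((s.1, s.1), s.2)) (by fun_prop)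
  obtain ⟨e, he⟩ := selection m hdimY _ (hO1.inter hO2) (by
    intro y
    convert fibre_contr n m p hp (f ⁻¹' {y}) (hperf.2.2 y) (hdimf y) h ε hε gt β hβ using 1
    ext u
    simp only [mem_inter_iff, mem_ofPred_eq, mem_preimage, mem_singleton_iff, P1, P2, mem_union,
      Prod.forall, Prod.map_apply, Prod.mk.injEq]
    refine and_congr Iff.rfl ?_
    constructor
    · intro H x hx x' hx' hd
      exact (H x x' ⟨hx, hx'⟩).resolve_left (not_lt.2 hd)
    · rintro H x x' ⟨hx, hx'⟩
      rcases lt_or_ge (dist (h x) (h x')) ε with hd | hd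
      · exact Or.inl hd
      · exact Or.inr (H x hx x' hx' hd))
  have hfc := hperf.1
  have he1 : ∀ x, dist (e (f x) x) (gt x) < β x := fun x => (he (f x)).1 x rfl
  have hcube : ∀ x, e (f x) x ∈ cube p := fun x =>
    cube_approx (g x) c _ (b x) (hb0 x) (hb1 x) (g x).2 hc (he1 x)
  refine ⟨⟨fun x => ⟨e (f x) x, hcube x⟩, Continuous.subtype_mk (by fun_prop) _⟩, ?_, ?_⟩
  · intro x
    change dist (g x : EuclideanSpace ℝ (Fin p)) (e (f x) x) ≤ α x
    have h1 := he1 x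
    have h2 := dist_triangle_right (g x : EuclideanSpace ℝ (Fin p)) (e (f x) x) (gt x)
    have h3 : dist (g x : EuclideanSpace ℝ (Fin p)) (gt x) =
        b x * ‖c - (g x : EuclideanSpace ℝ (Fin p))‖ := by
      rw [hgt, dist_self_add_right, norm_smul, Real.norm_of_nonneg (hb0 x).le]
    have h4 := hbα x
    have h5 : β x = b x / 2 := rfl
    have h6 := hb0 x
    rw [h3] at h2
    linarith
  · intro x x' hff hd heq
    have h1 : e (f x) x = e (f x') x' := congrArg Subtype.val heq
    rcases (he (f x)).2 (x, x') (by simp [hff]) with h2 | h2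
    · exact absurd h2 (not_lt.2 hd)
    · apply h2
      rw [← hff] at h1
      exact h1

lemma sep_open {X Y Z M : Type*} [TopologicalSpace X] [TopologicalSpace Y]
    [T2Space Y] [ParacompactSpace Y] [PseudoMetricSpace Z] [MetricSpace M]
    (f : X → Y) (hperf : IsPerfectMap f) (h : C(X, Z)) (ε : ℝ) :
    SLOpen {g : C(X, M) | ∀ x x', f x = f x' → ε ≤ dist (h x) (h x') → g x ≠ g x'} := by
  intro g hg
  have hpr := hperf.proper
  let P : Set ((X × X) × ℝ) := {s | dist (h s.1.1) (h s.1.2) < ε} ∪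
    {s | 3 * s.2 < dist (g s.1.1) (g s.1.2)}
  have hP : IsOpen P := (isOpen_lt (by fun_prop) (by fun_prop)).union
    (isOpen_lt (by fun_prop) (by fun_prop))
  have hO := (proper_forall_open (Prod.map f f) (hpr.prodMap hpr) P hP).preimage
    (f := fun s : Y × ℝ => ((s.1, s.1), s.2)) (by fun_prop)
  let t : Y → Set ℝ := fun y => {r | 0 < r ∧ ∀ x x', f x = y → f x' = y → ((x, x'), r) ∈ P}
  have hconv : ∀ y, Convex ℝ (t y) := by
    intro y
    apply Set.OrdConnected.convex
    constructor
    rintro r1 h1 r2 h2 r ⟨hr1, hr2⟩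
    refine ⟨lt_of_lt_of_le h1.1 hr1, fun x x' hx hx' => ?_⟩
    rcases h2.2 x x' hx hx' with h3 | h3
    · exact Or.inl h3
    · have h4 : 3 * r2 < dist (g x) (g x') := h3
      have h5 : 3 * r < dist (g x) (g x') := by linarith
      exact Or.inr h5
  obtain ⟨r, hr⟩ := exists_continuous_forall_mem_convex_of_local_const hconv (by
    intro y
    have hy : (y, (0 : ℝ)) ∈ (fun s : Y × ℝ => ((s.1, s.1), s.2)) ⁻¹'
        {s : (Y × Y) × ℝ | ∀ a, Prod.map f f a = s.1 → (a, s.2) ∈ P} := by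
      rintro ⟨x, x'⟩ hxx
      simp only [Prod.map_apply, Prod.mk.injEq] at hxx
      rcases lt_or_ge (dist (h x) (h x')) ε with hd | hd
      · exact Or.inl hd
      · refine Or.inr ?_
        simpa using hg x x' (hxx.1.trans hxx.2.symm) hd
    have hn := hO.mem_nhds hy
    rw [nhds_prod_eq, Filter.mem_prod_iff] at hn
    obtain ⟨s, hs, u, hu, hsu⟩ := hn
    obtain ⟨δ, hδ, hball⟩ := Metric.mem_nhds_iff.1 hu
    refine ⟨δ / 2, ?_⟩
    filter_upwards [hs] with y' hy'
    refine ⟨half_pos hδ, fun x x' hx hx' => ?_⟩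
    refine hsu (Set.mk_mem_prod hy' (hball ?_)) (x, x') ?_
    · rw [Metric.mem_ball, Real.dist_eq, sub_zero, abs_of_pos (half_pos hδ)]
      exact half_lt_self hδ
    · simp [hx, hx'])
  have hfc := hperf.1
  refine ⟨⟨fun x => r (f x), by fun_prop⟩, fun x => (hr (f x)).1, ?_⟩
  intro g' hg' x x' hff hd heq
  rcases (hr (f x)).2 x x' rfl hff.symm with h1 | h1
  · exact absurd h1 (not_lt.2 hd)
  · have h2 : dist (g x) (g' x) ≤ r (f x) := hg' x
    have h3 : dist (g x') (g' x') ≤ r (f x') := hg' x'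
    have h0 := (hr (f x)).1
    rw [← heq, ← hff] at h3
    have h4 := dist_triangle_right (g x) (g x') (g' x)
    have h5 : 3 * r (f x) < dist (g x) (g x') := h1
    linarith

lemma sl_step {X M : Type*} [TopologicalSpace X] [MetricSpace M] (F : Set C(X, M))
    (hF : SLOpen F)
    (hd : ∀ (g : C(X, M)) (α : C(X, ℝ)), (∀ x, 0 < α x) → ∃ g' ∈ F, ∀ x, dist (g x) (g' x) ≤ α x)
    (q : {q : C(X, M) × C(X, ℝ) // ∀ x, 0 < q.2 x}) :
    ∃ q' : {q : C(X, M) × C(X, ℝ) // ∀ x, 0 < q.2 x},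
      (∀ x, dist (q.1.1 x) (q'.1.1 x) ≤ q.1.2 x - q'.1.2 x) ∧ (∀ x, q'.1.2 x ≤ q.1.2 x / 2) ∧
      {u : C(X, M) | ∀ x, dist (q'.1.1 x) (u x) ≤ q'.1.2 x} ⊆ F := by
  obtain ⟨⟨g, α⟩, hα⟩ := q
  simp only at hα
  obtain ⟨g', hg', hgd⟩ := hd g ⟨fun x => α x / 2, by fun_prop⟩ (fun x => half_pos (hα x))
  obtain ⟨α', hα', hsub⟩ := hF g' hg'
  refine ⟨⟨(g', ⟨fun x => min (α' x) (α x / 2), by fun_prop⟩),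
    fun x => lt_min (hα' x) (half_pos (hα x))⟩, ?_, ?_, ?_⟩
  · intro x
    have h1 : dist (g x) (g' x) ≤ α x / 2 := hgd x
    have h2 : min (α' x) (α x / 2) ≤ α x / 2 := min_le_right _ _
    change dist (g x) (g' x) ≤ α x - min (α' x) (α x / 2)
    linarith
  · intro x
    exact min_le_right _ _
  · intro u hu
    exact hsub fun x => (hu x).trans (min_le_left _ _)

lemma sl_baire {X M : Type*} [TopologicalSpace X] [MetricSpace M] [CompleteSpace M]
    (F : ℕ → Set C(X, M)) (hF : ∀ k, SLOpen (F k))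
    (hd : ∀ k (g : C(X, M)) (α : C(X, ℝ)), (∀ x, 0 < α x) →
      ∃ g' ∈ F k, ∀ x, dist (g x) (g' x) ≤ α x) : SLDense (⋂ k, F k) := by
  rintro U hU ⟨g0, hg0⟩
  obtain ⟨α, hα, hαU⟩ := hU g0 hg0
  choose st hst1 hst2 hst3 using fun k => sl_step (F k) (hF k) (hd k)
  let q0 : {q : C(X, M) × C(X, ℝ) // ∀ x, 0 < q.2 x} :=
    ⟨(g0, ⟨fun x => min (α x) 1, by fun_prop⟩), fun x => lt_min (hα x) one_pos⟩
  let Q : ℕ → {q : C(X, M) × C(X, ℝ) // ∀ x, 0 < q.2 x} := fun k => Nat.rec q0 (fun k q => st k q) k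
  have hQ : ∀ k, Q (k + 1) = st k (Q k) := fun k => rfl
  have hdist1 : ∀ k x, dist ((Q k).1.1 x) ((Q (k + 1)).1.1 x) ≤ (Q k).1.2 x - (Q (k + 1)).1.2 x :=
    fun k x => by rw [hQ]; exact hst1 k (Q k) x
  have hdist : ∀ k l x, dist ((Q k).1.1 x) ((Q (k + l)).1.1 x) ≤ (Q k).1.2 x - (Q (k + l)).1.2 x := by
    intro k l x
    induction l with
    | zero => simp
    | succ l ih =>
      have h1 := hdist1 (k + l) x
      have h2 := dist_triangle ((Q k).1.1 x) ((Q (k + l)).1.1 x) ((Q (k + (l + 1))).1.1 x)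
      rw [← add_assoc] at h2 ⊢
      linarith
  have hsmall : ∀ k x, (Q k).1.2 x ≤ (1 / 2) ^ k := by
    intro k x
    induction k with
    | zero => exact (min_le_right _ _).trans (by simp)
    | succ k ih =>
      rw [hQ]
      refine (hst2 k (Q k) x).trans ?_
      rw [pow_succ]
      linarith
  have hpos : ∀ k x, 0 < (Q k).1.2 x := fun k => (Q k).2
  have hlim : ∀ x, ∃ y, Filter.Tendsto (fun k => (Q k).1.1 x) Filter.atTop (𝓝 y) := by
    intro x
    apply cauchySeq_tendsto_of_complete
    refine cauchySeq_of_le_geometric (1 / 2) 1 (by norm_num) fun k => ?_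
    have := hdist1 k x
    have h2 := hsmall k x
    have h3 := hpos (k + 1) x
    linarith
  choose u hu using hlim
  have hub : ∀ k x, dist ((Q k).1.1 x) (u x) ≤ (Q k).1.2 x := by
    intro k x
    have h1 : Filter.Tendsto (fun l => dist ((Q k).1.1 x) ((Q l).1.1 x)) Filter.atTop
        (𝓝 (dist ((Q k).1.1 x) (u x))) := tendsto_const_nhds.dist (hu x)
    refine le_of_tendsto h1 ?_
    filter_upwards [Filter.eventually_ge_atTop k] with l hl
    obtain ⟨d, rfl⟩ := Nat.exists_eq_add_of_le hl
    have h2 := hdist k d x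
    have h3 := hpos (k + d) x
    linarith
  have huni : TendstoUniformly (fun k x => (Q k).1.1 x) u Filter.atTop := by
    rw [Metric.tendstoUniformly_iff]
    intro ε hε
    have h1 : Filter.Tendsto (fun k : ℕ => ((1 : ℝ) / 2) ^ k) Filter.atTop (𝓝 0) :=
      tendsto_pow_atTop_nhds_zero_of_lt_one (by norm_num) (by norm_num)
    filter_upwards [h1.eventually_lt_const hε] with k hk x
    rw [dist_comm]
    exact lt_of_le_of_lt ((hub k x).trans (hsmall k x)) hk
  have hucont : Continuous u :=
    huni.continuous (Filter.Eventually.frequently (Filter.Eventually.of_forall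
      fun k => (Q k).1.1.continuous))
  refine ⟨⟨u, hucont⟩, hαU fun x => (hub 0 x).trans (min_le_left _ _), ?_⟩
  refine mem_iInter.2 fun k => ?_
  apply hst3 k (Q k)
  intro x
  rw [← hQ]
  exact hub (k + 1) x

lemma emb_iff {X Y M : Type*} [TopologicalSpace X] [TopologicalSpace Y] [T2Space Y]
    [TopologicalSpace M] [T2Space M] (f : X → Y) (hperf : IsPerfectMap f) (g : C(X, M)) :
    IsEmbedding (fun x => (f x, g x) : X → Y × M) ↔
      Function.Injective (fun x => (f x, g x) : X → Y × M) := by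
  refine ⟨fun h => h.injective, fun h => ?_⟩
  have hc : Continuous (fun x => (f x, g x) : X → Y × M) := hperf.1.prodMk g.continuous
  have hp : IsProperMap (fun x => (f x, g x) : X → Y × M) :=
    isProperMap_of_comp_of_t2 hc continuous_fst hperf.proper
  exact (IsClosedEmbedding.of_continuous_injective_isClosedMap hc h hp.isClosedMap).isEmbedding

/-- Theorem 1.1(i). Let `f : X → Y` be a perfect surjection of countable
functional weight between paracompact Hausdorff spaces with `dim f ≤ n` and `dim Y ≤ m`. Then the
set of all `g ∈ C(X, I^{2n+1+m})` for which `f × g` is an embedding into `Y × I^{2n+1+m}` is dense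
and `G_δ` in `C(X, I^{2n+1+m})` with the source limitation topology. -/
theorem stmt0 {X Y : Type*} [TopologicalSpace X] [TopologicalSpace Y]
    [T2Space X] [T2Space Y] [ParacompactSpace X] [ParacompactSpace Y]
    (n m : ℕ) (f : X → Y) (hperf : IsPerfectMap f) (hsurj : Function.Surjective f)
    (hw : HasCountableFunctionalWeight f)
    (hdimf : ∀ y : Y, CovDimLE ↥(f ⁻¹' {y}) n)
    (hdimY : CovDimLE Y m) :
    SLDense {g : C(X, ↥(cube (2*n+1+m))) |
        IsEmbedding (fun x => (f x, g x) : X → Y × ↥(cube (2*n+1+m)))} ∧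
    SLGdelta {g : C(X, ↥(cube (2*n+1+m))) |
        IsEmbedding (fun x => (f x, g x) : X → Y × ↥(cube (2*n+1+m)))} := by
  obtain ⟨h, hh⟩ := hw
  let F : ℕ → Set C(X, ↥(cube (2*n+1+m))) := fun k =>
    {g | ∀ x x', f x = f x' → 1 / ((k : ℝ) + 1) ≤ dist (h x) (h x') → g x ≠ g x'}
  have hFo : ∀ k, SLOpen (F k) := fun k => sep_open f hperf h _
  have hset : {g : C(X, ↥(cube (2*n+1+m))) |
      IsEmbedding (fun x => (f x, g x) : X → Y × ↥(cube (2*n+1+m)))} = ⋂ k, F k := by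
    ext g
    rw [mem_ofPred_eq, emb_iff f hperf g, mem_iInter]
    constructor
    · intro hinj k x x' hff hd heq
      have hxx : x = x' := hinj (Prod.ext hff heq)
      subst hxx
      rw [dist_self] at hd
      have : 0 < 1 / ((k : ℝ) + 1) := Nat.one_div_pos_of_nat
      linarith
    · intro hk x x' hxx
      simp only [Prod.mk.injEq] at hxx
      by_contra hne
      have hhne : h x ≠ h x' := fun he => hne (hh.injective (Prod.ext hxx.1 he))
      obtain ⟨k, hkk⟩ := exists_nat_one_div_lt (dist_pos.2 hhne)
      exact hk k x x' hxx.1 hkk.le hxx.2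
  have hclosed : IsClosed (cube (2*n+1+m)) := by
    have : cube (2*n+1+m) = ⋂ i, {x : EuclideanSpace ℝ (Fin (2*n+1+m)) | x i ∈ Set.Icc (0:ℝ) 1} := by
      ext x; simp [cube]
    rw [this]
    exact isClosed_iInter fun i => isClosed_Icc.preimage (by fun_prop)
  have : CompleteSpace (cube (2*n+1+m)) := hclosed.completeSpace_coe
  rw [hset]
  refine ⟨sl_baire F hFo ?_, F, hFo, rfl⟩
  intro k g α hα
  obtain ⟨g', h1, h2⟩ := dens n m _ rfl f hperf hdimf hdimY h (1 / ((k : ℝ) + 1))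
    Nat.one_div_pos_of_nat g α hα
  exact ⟨g', h2, h1⟩
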